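/- For every α ∈ (0,1) there exist constants c > 0 and C > 0 such that the following holds. Let q be a prime power, n ≥ 1, let 𝝁 = (μ_ij) be an n×n matrix of α-balanced probability measures on F_q, and let M ~ M(𝝁). Then |P(M is nonsingular) − ∏_{i=1}^∞ (1 − q^{−i})| ≤ C e^{−cαn}. -/

import Mathlib

/- STATEMENT 2: For every α ∈ (0,1) there are c, C > 0 such that for any prime power q,
n ≥ 1, and n×n matrix 𝝁 of α-balanced measures on F_q, for M ~ M(𝝁),
|P(M nonsingular) − ∏_{i=1}^∞ (1 − q^{−i})| ≤ C e^{−cαn}. -/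

open scoped Classical

noncomputable section

/-- `μ` is an `α`-balanced probability measure on the finite additive group `F`:
every coset of a proper subgroup has mass at most `1 - α`. -/
def IsBalanced {F : Type*} [AddCommGroup F] [Fintype F] (α : ℝ) (μ : F → ℝ) : Prop :=
  (∀ x, 0 ≤ μ x) ∧ (∑ x, μ x = 1) ∧
    ∀ (x : F) (H : AddSubgroup F), H ≠ ⊤ →
      ∑ y ∈ Finset.univ.filter (fun y => y - x ∈ H), μ y ≤ 1 - α

/-- The probability of an event `E` for a random `n × n` matrix over a finite field
with independent entries, the `(i,j)` entry having law `μ i j`. -/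
def matProb {F : Type*} [Fintype F] {n : ℕ} (μ : Fin n → Fin n → F → ℝ)
    (E : Set (Matrix (Fin n) (Fin n) F)) : ℝ :=
  ∑ M ∈ Finset.univ.filter (fun M : Matrix (Fin n) (Fin n) F => M ∈ E),
    ∏ i, ∏ j, μ i j (M i j)

/-- A nonempty symmetric set of doubling less than `3/2` has a subgroup as its sumset. -/
theorem exists_addSubgroup_eq_add_of_small_doubling {G : Type*} [AddCommGroup G]
    (A : Finset G) (hA : A.Nonempty) (hneg : ∀ x ∈ A, -x ∈ A)
    (hcard : 2 * (Finset.image₂ (· + ·) A A).card < 3 * A.card) :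
    ∃ H : AddSubgroup G, ∀ x, x ∈ H ↔ x ∈ Finset.image₂ (· + ·) A A := by
  set B := Finset.image₂ (· + ·) A A with hB
  have hsub : ∀ x, x ∈ B → ∃ a ∈ A, ∃ b ∈ A, x = a - b := by
    intro x hx
    obtain ⟨a, ha, b, hb, rfl⟩ := Finset.mem_image₂.1 hx
    exact ⟨a, ha, -b, hneg b hb, by simp⟩
  have hsub' : ∀ a ∈ A, ∀ b ∈ A, a - b ∈ B := by
    intro a ha b hb
    exact Finset.mem_image₂.2 ⟨a, ha, -b, hneg b hb, by simp [sub_eq_add_neg]⟩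
  have key : ∀ x ∈ B, A.card < 2 * (A.filter (fun a => x + a ∈ A)).card := by
    intro x hx
    obtain ⟨a, ha, b, hb, rfl⟩ := hsub x hx
    have h1 : (A.image (fun c => a + c)).card = A.card :=
      Finset.card_image_of_injective _ (add_right_injective a)
    have h2 : (A.image (fun c => b + c)).card = A.card :=
      Finset.card_image_of_injective _ (add_right_injective b)
    have h3 : (A.image (fun c => a + c)) ∪ (A.image (fun c => b + c)) ⊆ B := by
      intro y hy
      rcases Finset.mem_union.1 hy with h | h
      · obtain ⟨c, hc, rfl⟩ := Finset.mem_image.1 h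
        exact Finset.mem_image₂.2 ⟨a, ha, c, hc, rfl⟩
      · obtain ⟨c, hc, rfl⟩ := Finset.mem_image.1 h
        exact Finset.mem_image₂.2 ⟨b, hb, c, hc, rfl⟩
    have h4 := Finset.card_le_card h3
    have h5 := Finset.card_union_add_card_inter
      (A.image (fun c => a + c)) (A.image (fun c => b + c))
    have h6 : ((A.image (fun c => a + c)) ∩ (A.image (fun c => b + c))).card ≤
        (A.filter (fun c => a - b + c ∈ A)).card := by
      apply Finset.card_le_card_of_injOn (fun y => y - a)
      · intro y hy
        obtain ⟨hy1, hy2⟩ := Finset.mem_inter.1 (Finset.mem_coe.1 hy)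
        obtain ⟨c, hc, rfl⟩ := Finset.mem_image.1 hy1
        obtain ⟨e, he, hee⟩ := Finset.mem_image.1 hy2
        have : a - b + c = e := by
          have : b + e = a + c := hee
          rw [sub_add_eq_add_sub, ← this]; abel
        simp [hc, this, he]
      · intro y _ z _ h
        simpa using h
    omega
  have hdiff : ∀ x ∈ B, ∀ y ∈ B, x - y ∈ B := by
    intro x hx y hy
    have h1 := key x hx
    have h2 := key y hy
    have h5 := Finset.card_union_add_card_inter
      (A.filter (fun a => x + a ∈ A)) (A.filter (fun a => y + a ∈ A))
    have h6 : ((A.filter (fun a => x + a ∈ A)) ∪ (A.filter (fun a => y + a ∈ A))).card ≤ A.card :=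
      Finset.card_le_card (Finset.union_subset (Finset.filter_subset _ _) (Finset.filter_subset _ _))
    have h7 : 0 < ((A.filter (fun a => x + a ∈ A)) ∩ (A.filter (fun a => y + a ∈ A))).card := by
      omega
    obtain ⟨c, hc⟩ := Finset.card_pos.1 h7
    simp only [Finset.mem_inter, Finset.mem_filter] at hc
    have := hsub' _ hc.1.2 _ hc.2.2
    simpa using this
  have h0 : (0 : G) ∈ B := by
    obtain ⟨a, ha⟩ := hA
    simpa using hsub' a ha a ha
  refine ⟨{ carrier := B, zero_mem' := h0, add_mem' := ?_, neg_mem' := ?_ }, fun x => Iff.rfl⟩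
  · intro x y hx hy
    have := hdiff x hx (0 - y) (hdiff 0 h0 y hy)
    simpa using this
  · intro x hx
    have := hdiff 0 h0 x hx
    simpa using this

/-- The number of nonzero points in a sublevel set of `h`. -/
def sublevelCount {G : Type*} [AddCommGroup G] [Fintype G] (h : G → ℝ) (R : ℝ) : ℕ :=
  (Finset.univ.filter (fun x : G => x ≠ 0 ∧ h x ≤ R)).card

theorem sublevelCount_growth {G : Type*} [AddCommGroup G] [Fintype G] (h : G → ℝ) (T : ℝ)
    (h0 : h 0 = 0) (hnn : ∀ x, 0 ≤ h x)
    (hneg : ∀ x, h (-x) = h x) (hadd : ∀ x y, h (x + y) ≤ 2 * h x + 2 * h y)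
    (hsub : ∀ H : AddSubgroup G, H ≠ ⊥ → ∃ x ∈ H, T ≤ h x) (R : ℝ) (hR : 4 * R < T) :
    (sublevelCount h R : ℝ) ≤ 2 / 3 * sublevelCount h (4 * R) := by
  by_cases hN : sublevelCount h R = 0
  · rw [hN]; exact mul_nonneg (by norm_num) (Nat.cast_nonneg _) |>.trans' (by simp)
  obtain ⟨x₀, hx₀⟩ := Finset.card_pos.1 (Nat.pos_of_ne_zero hN)
  simp only [Finset.mem_filter, Finset.mem_univ, true_and] at hx₀
  have hR0 : 0 ≤ R := (hnn x₀).trans hx₀.2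
  have hcount : ∀ R', 0 ≤ R' →
      (Finset.univ.filter (fun x : G => h x ≤ R')).card = sublevelCount h R' + 1 := by
    intro R' hR'
    have : Finset.univ.filter (fun x : G => h x ≤ R') =
        insert 0 (Finset.univ.filter (fun x : G => x ≠ 0 ∧ h x ≤ R')) := by
      ext x
      by_cases hx : x = 0
      · simp [hx, h0, hR']
      · simp [hx]
    rw [this, Finset.card_insert_of_notMem (by simp)]
    rfl
  set A := Finset.univ.filter (fun x : G => h x ≤ R) with hA
  have hAA : Finset.image₂ (· + ·) A A ⊆ Finset.univ.filter (fun x : G => h x ≤ 4 * R) := by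
    intro z hz
    obtain ⟨a, ha, b, hb, rfl⟩ := Finset.mem_image₂.1 hz
    simp only [hA, Finset.mem_filter, Finset.mem_univ, true_and] at ha hb ⊢
    linarith [hadd a b]
  have h1 := hcount R hR0
  have h2 := hcount (4 * R) (by linarith)
  have h3 := Finset.card_le_card hAA
  by_cases hd : 2 * (Finset.image₂ (· + ·) A A).card < 3 * A.card
  · exfalso
    obtain ⟨H, hH⟩ := exists_addSubgroup_eq_add_of_small_doubling A
      ⟨0, by simp [hA, h0, hR0]⟩ (by intro x hx; simpa [hA, hneg] using hx) hd
    have hx0H : x₀ ∈ H := by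
      rw [hH]
      exact Finset.mem_image₂.2 ⟨x₀, by simp [hA, hx₀.2], 0, by simp [hA, h0, hR0], by simp⟩
    obtain ⟨y, hy, hyT⟩ := hsub H (by
      rintro rfl
      exact hx₀.1 (by simpa using hx0H))
    rw [hH] at hy
    have := hAA hy
    simp only [Finset.mem_filter, Finset.mem_univ, true_and] at this
    linarith
  · have : 3 * sublevelCount h R ≤ 2 * sublevelCount h (4 * R) := by
      rw [← hA] at h1
      omega
    have h' : (3 : ℝ) * sublevelCount h R ≤ 2 * sublevelCount h (4 * R) := by exact_mod_cast this
    linarith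

theorem sublevelCount_growth_iterate {G : Type*} [AddCommGroup G] [Fintype G] (h : G → ℝ) (T : ℝ)
    (h0 : h 0 = 0) (hnn : ∀ x, 0 ≤ h x)
    (hneg : ∀ x, h (-x) = h x) (hadd : ∀ x y, h (x + y) ≤ 2 * h x + 2 * h y)
    (hsub : ∀ H : AddSubgroup G, H ≠ ⊥ → ∃ x ∈ H, T ≤ h x) (m : ℕ) :
    ∀ R : ℝ, 0 ≤ R → 4 ^ m * R < T →
    (sublevelCount h R : ℝ) ≤ (2 / 3) ^ m * sublevelCount h (4 ^ m * R) := by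
  induction m with
  | zero => intro R _ _; simp
  | succ m ih =>
    intro R hR0 hR
    have hle : (4 : ℝ) ^ m * R ≤ 4 ^ (m + 1) * R := by
      rw [pow_succ]; nlinarith [mul_nonneg (pow_nonneg (by norm_num : (0 : ℝ) ≤ 4) m) hR0]
    have h1 := ih R hR0 (lt_of_le_of_lt hle hR)
    have h2 := sublevelCount_growth h T h0 hnn hneg hadd hsub (4 ^ m * R)
      (by rw [pow_succ] at hR; linarith)
    have h3 : 4 * ((4 : ℝ) ^ m * R) = 4 ^ (m + 1) * R := by ring
    rw [h3] at h2
    calc (sublevelCount h R : ℝ) ≤ (2 / 3) ^ m * sublevelCount h (4 ^ m * R) := h1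
      _ ≤ (2 / 3) ^ m * (2 / 3 * sublevelCount h (4 ^ (m + 1) * R)) := by gcongr
      _ = _ := by ring

theorem integral_indicator_le_self {a : ℝ} (h0 : 0 ≤ a) (h1 : a ≤ 1) :
    ∫ u in Set.Ioc (0 : ℝ) 1, (Set.Iic a).indicator (fun _ => (1 : ℝ)) u = a := by
  rw [MeasureTheory.setIntegral_indicator measurableSet_Iic]
  have : Set.Ioc (0 : ℝ) 1 ∩ Set.Iic a = Set.Ioc 0 a := by
    ext u; simp only [Set.mem_inter_iff, Set.mem_Ioc, Set.mem_Iic]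
    constructor
    · rintro ⟨⟨h, _⟩, h'⟩; exact ⟨h, h'⟩
    · rintro ⟨h, h'⟩; exact ⟨⟨h, h'.trans h1⟩, h'⟩
  rw [this]
  simp [h0]

/-- Domination of superlevel counts above the level `u₀` gives domination of sums. -/
theorem sum_le_of_superlevel_card_le {Ω : Type*} (s : Finset Ω) (f g : Ω → ℝ) (κ u₀ : ℝ)
    (hκ : 0 ≤ κ)
    (hu₀ : 0 ≤ u₀) (hf0 : ∀ x ∈ s, 0 ≤ f x) (hf1 : ∀ x ∈ s, f x ≤ 1) (hg0 : ∀ x ∈ s, 0 ≤ g x)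
    (hg1 : ∀ x ∈ s, g x ≤ 1)
    (hcard : ∀ u, u₀ < u → u ≤ 1 → ((s.filter (fun x => u ≤ f x)).card : ℝ) ≤
      κ * (s.filter (fun x => u ≤ g x)).card) :
    ∑ x ∈ s, f x ≤ κ * ∑ x ∈ s, g x + s.card * u₀ := by
  by_cases hu1 : 1 < u₀
  · have h1 : ∑ x ∈ s, f x ≤ s.card * u₀ := by
      rw [← nsmul_eq_mul]
      exact Finset.sum_le_card_nsmul _ _ _ (fun x hx => (hf1 x hx).trans hu1.le)
    have h2 : 0 ≤ κ * ∑ x ∈ s, g x := mul_nonneg hκ (Finset.sum_nonneg hg0)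
    linarith
  push Not at hu1
  have hindInt : ∀ a : ℝ, MeasureTheory.IntegrableOn
      ((Set.Iic a).indicator (fun _ => (1 : ℝ))) (Set.Ioc (0 : ℝ) 1) := by
    intro a
    exact (MeasureTheory.integrable_const (1 : ℝ)).indicator measurableSet_Iic
  have hrep : ∀ φ : Ω → ℝ, (∀ x ∈ s, 0 ≤ φ x) → (∀ x ∈ s, φ x ≤ 1) →
      ∑ x ∈ s, φ x = ∫ u in Set.Ioc (0 : ℝ) 1,
        ∑ x ∈ s, (Set.Iic (φ x)).indicator (fun _ => (1 : ℝ)) u := by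
    intro φ h0 h1
    rw [MeasureTheory.integral_finsetSum _ (fun x _ => hindInt (φ x))]
    exact Finset.sum_congr rfl
      (fun x hx => (integral_indicator_le_self (h0 x hx) (h1 x hx)).symm)
  have hcount : ∀ φ : Ω → ℝ, ∀ u, ∑ x ∈ s, (Set.Iic (φ x)).indicator (fun _ => (1 : ℝ)) u =
      (s.filter (fun x => u ≤ φ x)).card := by
    intro φ u
    simp [Set.indicator_apply]
  rw [hrep f hf0 hf1, hrep g hg0 hg1]
  have h3 : (s.card : ℝ) * u₀ = ∫ u in Set.Ioc (0 : ℝ) 1,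
      (s.card : ℝ) * (Set.Iic u₀).indicator (fun _ => (1 : ℝ)) u := by
    rw [MeasureTheory.integral_const_mul, integral_indicator_le_self hu₀ hu1]
  rw [h3, ← MeasureTheory.integral_const_mul, ← MeasureTheory.integral_add]
  · apply MeasureTheory.setIntegral_mono_on
    · exact MeasureTheory.integrable_finsetSum _ (fun x _ => hindInt (f x))
    · exact ((MeasureTheory.integrable_finsetSum _ (fun x _ => hindInt (g x))).const_mul κ).add
        ((hindInt u₀).const_mul _)
    · exact measurableSet_Ioc
    · intro u hu
      rw [hcount, hcount]
      by_cases h : u ≤ u₀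
      · have h4 : ((s.filter (fun x => u ≤ f x)).card : ℝ) ≤ s.card := by
          exact_mod_cast Finset.card_filter_le _ _
        have h5 : 0 ≤ κ * ((s.filter (fun x => u ≤ g x)).card : ℝ) := by positivity
        simp only [Set.indicator_apply, Set.mem_Iic, h, if_true]
        linarith
      · have := hcard u (not_le.1 h) hu.2
        simp only [Set.indicator_apply, Set.mem_Iic, h, if_false]
        linarith
  · exact (MeasureTheory.integrable_finsetSum _ (fun x _ => hindInt (g x))).const_mul κ
  · exact (hindInt u₀).const_mul _

/-- Halász-type comparison of exponential sums over a finite group. -/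
theorem sum_exp_neg_half_le {G : Type*} [AddCommGroup G] [Fintype G]
    [DecidablePred fun x : G => x ≠ 0] (h : G → ℝ) (T : ℝ)
    (h0 : h 0 = 0) (hnn : ∀ x, 0 ≤ h x)
    (hneg : ∀ x, h (-x) = h x) (hadd : ∀ x y, h (x + y) ≤ 2 * h x + 2 * h y)
    (hsub : ∀ H : AddSubgroup G, H ≠ ⊥ → ∃ x ∈ H, T ≤ h x) (m : ℕ) :
    ∑ x ∈ Finset.univ.filter (fun x : G => x ≠ 0), Real.exp (-(h x / 2)) ≤
      (2 / 3) ^ m * ∑ x ∈ Finset.univ.filter (fun x : G => x ≠ 0),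
        Real.exp (-(h x / (2 * 4 ^ m))) +
      Fintype.card G * Real.exp (-(T / (2 * 4 ^ m))) := by
  have h4 : (0 : ℝ) < 4 ^ m := by positivity
  refine (sum_le_of_superlevel_card_le _ _ (fun x => Real.exp (-(h x / (2 * 4 ^ m))))
    ((2 / 3) ^ m) (Real.exp (-(T / (2 * 4 ^ m)))) (by positivity) (Real.exp_pos _).le
    (fun x _ => (Real.exp_pos _).le) ?_ (fun x _ => (Real.exp_pos _).le) ?_ ?_).trans ?_
  · intro x _
    rw [Real.exp_le_one_iff]; linarith [hnn x]
  · intro x _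
    rw [Real.exp_le_one_iff]
    have := hnn x
    have : 0 ≤ h x / (2 * 4 ^ m) := by positivity
    linarith
  · intro u hu hu1
    have hu0 : 0 < u := (Real.exp_pos _).trans hu
    have hR0 : 0 ≤ -(2 * Real.log u) := by
      have := Real.log_nonpos hu0.le hu1
      linarith
    have hRT : 4 ^ m * (-(2 * Real.log u)) < T := by
      have := (Real.lt_log_iff_exp_lt hu0).2 hu
      have h5 : -Real.log u < T / (2 * 4 ^ m) := by linarith
      rw [lt_div_iff₀ (by positivity)] at h5
      linarith
    have key := sublevelCount_growth_iterate h T h0 hnn hneg hadd hsub m _ hR0 hRT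
    have e1 : ((Finset.univ.filter (fun x : G => x ≠ 0)).filter
        (fun x => u ≤ Real.exp (-(h x / 2)))).card = sublevelCount h (-(2 * Real.log u)) := by
      rw [sublevelCount, Finset.filter_filter]
      congr 1
      ext x
      simp only [Finset.mem_filter, Finset.mem_univ, true_and, and_congr_right_iff]
      intro _
      rw [← Real.log_le_iff_le_exp hu0]
      constructor <;> intro <;> linarith
    have e2 : ((Finset.univ.filter (fun x : G => x ≠ 0)).filter
        (fun x => u ≤ Real.exp (-(h x / (2 * 4 ^ m))))).card =
          sublevelCount h (4 ^ m * (-(2 * Real.log u))) := by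
      rw [sublevelCount, Finset.filter_filter]
      congr 1
      ext x
      simp only [Finset.mem_filter, Finset.mem_univ, true_and, and_congr_right_iff]
      intro _
      rw [← Real.log_le_iff_le_exp hu0, le_neg, div_le_iff₀ (by positivity)]
      constructor <;> intro <;> linarith
    rw [e1, e2]
    exact key
  · gcongr
    exact Finset.card_le_univ _

/-- The product of the weights `u a`. -/
def prodWeight {κ E : Type*} [Fintype κ] (u : κ → E → ℝ) (x : κ → E) : ℝ := ∏ a, u a (x a)

/-- The total weight of a submodule. -/
def submoduleMass {F E : Type*} [Field F] [AddCommGroup E] [Module F E] [Fintype E]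
    (w : E → ℝ) (V : Submodule F E) : ℝ := ∑ x ∈ Finset.univ.filter (fun x => x ∈ V), w x

theorem prodWeight_nonneg {κ E : Type*} [Fintype κ] {u : κ → E → ℝ} (hu : ∀ a x, 0 ≤ u a x)
    (x : κ → E) : 0 ≤ prodWeight u x := Finset.prod_nonneg (fun a _ => hu a _)

theorem sum_prodWeight {κ E : Type*} [Fintype κ] [DecidableEq κ] [Fintype E] (u : κ → E → ℝ) :
    ∑ x, prodWeight u x = ∏ a, ∑ z, u a z := by
  rw [Finset.prod_univ_sum, Fintype.piFinset_univ]
  rfl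

theorem submoduleMass_nonneg {F E : Type*} [Field F] [AddCommGroup E] [Module F E] [Fintype E]
    {w : E → ℝ} (hw : ∀ x, 0 ≤ w x) (V : Submodule F E) : 0 ≤ submoduleMass w V :=
  Finset.sum_nonneg (fun x _ => hw x)

section Fourier

variable {F : Type*} [Field F] [Fintype F] {ι : Type*} [Fintype ι] [DecidableEq ι]

theorem exists_isPrimitive_addChar (F : Type*) [Field F] [Fintype F] :
    ∃ ψ : AddChar F ℂ, ψ.IsPrimitive := by
  obtain ⟨ψ, hψ⟩ := AddChar.exists_apply_ne_zero.2 (one_ne_zero (α := F))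
  exact ⟨ψ, AddChar.IsPrimitive.of_ne_one (by rintro rfl; simp at hψ)⟩

theorem IsBalanced.apply_le {α : ℝ} {μ : F → ℝ} (h : IsBalanced α μ) (x : F) : μ x ≤ 1 - α := by
  have := h.2.2 x ⊥ bot_ne_top
  have e : Finset.univ.filter (fun y => y - x ∈ (⊥ : AddSubgroup F)) = {x} := by
    ext y; simp [sub_eq_zero]
  rwa [e, Finset.sum_singleton] at this

/-- The orthogonal complement with respect to the dot product. -/
def perp (V : Submodule F (ι → F)) : Submodule F (ι → F) :=
  LinearMap.BilinForm.orthogonal (dotProductBilin F F) V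

theorem mem_perp {V : Submodule F (ι → F)} {ξ : ι → F} :
    ξ ∈ perp V ↔ ∀ x ∈ V, x ⬝ᵥ ξ = 0 := Iff.rfl

theorem dotProductBilin_nondegenerate :
    LinearMap.BilinForm.Nondegenerate (dotProductBilin F F (m := ι)) := by
  constructor
  · intro x hx
    exact dotProduct_eq_zero _ (fun w => by simpa using hx w)
  · intro x hx
    exact dotProduct_eq_zero _ (fun w => by rw [dotProduct_comm]; simpa using hx w)

theorem dotProductBilin_isRefl :
    LinearMap.BilinForm.IsRefl (dotProductBilin F F (m := ι)) := by
  intro x y h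
  have : x ⬝ᵥ y = 0 := h
  change y ⬝ᵥ x = 0
  rwa [dotProduct_comm]

theorem perp_perp (V : Submodule F (ι → F)) : perp (perp V) = V :=
  LinearMap.BilinForm.orthogonal_orthogonal dotProductBilin_nondegenerate
    dotProductBilin_isRefl V

theorem card_perp (V : Submodule F (ι → F)) :
    Fintype.card (perp V) =
      Fintype.card F ^ (Fintype.card ι - Module.finrank F V) := by
  rw [Module.card_eq_pow_finrank (K := F) (V := perp V)]
  congr 1
  have := LinearMap.BilinForm.finrank_orthogonal (dotProductBilin_nondegenerate (F := F) (ι := ι)) V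
  rw [Module.finrank_fintype_fun_eq_card] at this
  exact this

/-- The Fourier transform of `u` at the frequency `s`. -/
def charSum (ψ : AddChar F ℂ) (u : F → ℝ) (s : F) : ℂ := ∑ x, (u x : ℂ) * ψ (s * x)

theorem sum_perp_addChar {ψ : AddChar F ℂ} (hψ : ψ.IsPrimitive) (V : Submodule F (ι → F))
    (x : ι → F) :
    ∑ ξ : perp V, ψ (ξ.1 ⬝ᵥ x) = if x ∈ V then (Fintype.card (perp V) : ℂ) else 0 := by
  let χ : AddChar (perp V) ℂ :=
    { toFun := fun ξ => ψ (ξ.1 ⬝ᵥ x)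
      map_zero_eq_one' := by simp
      map_add_eq_mul' := by intro a b; simp [add_dotProduct, AddChar.map_add_eq_mul] }
  have h1 : ∑ ξ : perp V, ψ (ξ.1 ⬝ᵥ x) = ∑ ξ, χ ξ := rfl
  rw [h1, AddChar.sum_eq_ite]
  have h2 : χ = 0 ↔ x ∈ V := by
    constructor
    · intro h
      by_contra hx
      rw [← perp_perp V, mem_perp] at hx
      push Not at hx
      obtain ⟨ξ, hξ, hne⟩ := hx
      refine hψ hne ?_
      ext t
      have h3 := DFunLike.congr_fun h ⟨t • ξ, (perp V).smul_mem t hξ⟩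
      have h4 : ψ ((t • ξ) ⬝ᵥ x) = 1 := h3
      rw [smul_dotProduct, smul_eq_mul, mul_comm] at h4
      simpa [AddChar.mulShift_apply] using h4
    · intro hx
      ext ξ
      have h3 : ξ.1 ⬝ᵥ x = 0 := by rw [dotProduct_comm]; exact mem_perp.1 ξ.2 x hx
      change ψ (ξ.1 ⬝ᵥ x) = 1
      simp [h3]
  simp only [h2]

theorem addChar_sum_eq_prod {κ : Type*} (ψ : AddChar F ℂ) (s : Finset κ) (f : κ → F) :
    ψ (∑ j ∈ s, f j) = ∏ j ∈ s, ψ (f j) := by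
  induction s using Finset.induction_on with
  | empty => simp
  | insert a s ha ih => rw [Finset.sum_insert ha, Finset.prod_insert ha,
      AddChar.map_add_eq_mul, ih]

theorem card_perp_mul_submoduleMass {ψ : AddChar F ℂ} (hψ : ψ.IsPrimitive)
    (V : Submodule F (ι → F)) (u : ι → F → ℝ) :
    (Fintype.card (perp V) : ℂ) * (submoduleMass (prodWeight u) V : ℝ) =
      ∑ ξ : perp V, ∏ j, charSum ψ (u j) (ξ.1 j) := by
  have h1 : ∀ ξ : perp V, ∏ j, charSum ψ (u j) (ξ.1 j) =
      ∑ x : ι → F, ((prodWeight u x : ℝ) : ℂ) * ψ (ξ.1 ⬝ᵥ x) := by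
    intro ξ
    simp only [charSum]
    rw [Finset.prod_univ_sum, Fintype.piFinset_univ]
    refine Finset.sum_congr rfl fun x _ => ?_
    rw [dotProduct, addChar_sum_eq_prod, Finset.prod_mul_distrib, prodWeight, Complex.ofReal_prod]
  simp only [h1]
  rw [Finset.sum_comm]
  simp only [← Finset.mul_sum, sum_perp_addChar hψ]
  rw [submoduleMass, Complex.ofReal_sum, Finset.mul_sum, Finset.sum_filter]
  refine Finset.sum_congr rfl fun x _ => ?_
  split_ifs <;> ring

/-- The bias of a product measure on `V`: an upper bound for the deviation of the mass of `V`
from its uniform value. -/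
def bias (ψ : AddChar F ℂ) (u : ι → F → ℝ) (V : Submodule F (ι → F)) : ℝ :=
  (Fintype.card (perp V) : ℝ)⁻¹ *
    ∑ ξ ∈ Finset.univ.filter (fun ξ : perp V => ξ ≠ 0), ∏ j, ‖charSum ψ (u j) (ξ.1 j)‖

theorem bias_nonneg (ψ : AddChar F ℂ) (u : ι → F → ℝ) (V : Submodule F (ι → F)) :
    0 ≤ bias ψ u V := by
  unfold bias; positivity

theorem charSum_zero (ψ : AddChar F ℂ) {u : F → ℝ} (hu : ∑ x, u x = 1) :
    charSum ψ u 0 = 1 := by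
  simp [charSum, ← Complex.ofReal_sum, hu]

theorem sum_univ_eq_zero_add {G : Type*} [AddCommGroup G] [Fintype G] {M : Type*}
    [AddCommMonoid M] [DecidablePred fun x : G => x ≠ 0] (f : G → M) :
    ∑ x, f x = f 0 + ∑ x ∈ Finset.univ.filter (fun x : G => x ≠ 0), f x := by
  rw [← Finset.add_sum_erase _ _ (Finset.mem_univ 0)]
  congr 2
  ext x; simp

theorem abs_submoduleMass_sub_le {ψ : AddChar F ℂ} (hψ : ψ.IsPrimitive)
    (V : Submodule F (ι → F)) {u : ι → F → ℝ} (hu : ∀ j, ∑ x, u j x = 1) :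
    |submoduleMass (prodWeight u) V - (Fintype.card (perp V) : ℝ)⁻¹| ≤ bias ψ u V := by
  have hc : (0 : ℝ) < Fintype.card (perp V) := by exact_mod_cast Fintype.card_pos
  have h := card_perp_mul_submoduleMass hψ V u
  rw [sum_univ_eq_zero_add] at h
  simp only [ZeroMemClass.coe_zero, Pi.zero_apply, charSum_zero ψ (hu _),
    Finset.prod_const_one] at h
  have h1 : ‖((Fintype.card (perp V) * submoduleMass (prodWeight u) V - 1 : ℝ) : ℂ)‖ ≤
      ∑ ξ ∈ Finset.univ.filter (fun ξ : perp V => ξ ≠ 0), ∏ j, ‖charSum ψ (u j) (ξ.1 j)‖ := by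
    push_cast
    rw [h, add_sub_cancel_left]
    refine (norm_sum_le _ _).trans (Finset.sum_le_sum fun ξ _ => ?_)
    rw [norm_prod]
  rw [Complex.norm_real, Real.norm_eq_abs] at h1
  have h2 : submoduleMass (prodWeight u) V - (Fintype.card (perp V) : ℝ)⁻¹ =
      (Fintype.card (perp V) : ℝ)⁻¹ * (Fintype.card (perp V) * submoduleMass (prodWeight u) V - 1) := by
    field_simp
  rw [h2, abs_mul, abs_of_pos (inv_pos.2 hc), bias]
  gcongr

/-- The lazy symmetrization of `u`. -/
def lazySymm (β : ℝ) (u : F → ℝ) (x : F) : ℝ :=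
  (1 - β) * (if x = 0 then 1 else 0) + β * ∑ y, u (x + y) * u y

theorem charSum_lazySymm (ψ : AddChar F ℂ) (β : ℝ) (u : F → ℝ) (s : F) :
    charSum ψ (lazySymm β u) s = ((1 - β + β * ‖charSum ψ u s‖ ^ 2 : ℝ) : ℂ) := by
  have h1 : ((‖charSum ψ u s‖ ^ 2 : ℝ) : ℂ) =
      ∑ x, ∑ y, ((u (x + y) * u y : ℝ) : ℂ) * ψ (s * x) := by
    rw [← Complex.normSq_eq_norm_sq, ← Complex.mul_conj, charSum, map_sum, Finset.mul_sum,
      Finset.sum_comm]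
    refine Finset.sum_congr rfl fun y _ => ?_
    rw [Finset.sum_mul, ← Equiv.sum_comp (Equiv.addRight y)]
    refine Finset.sum_congr rfl fun x _ => ?_
    simp only [Equiv.coe_addRight, map_mul, Complex.conj_ofReal]
    rw [← AddChar.map_neg_eq_conj]
    push_cast
    have : ψ (s * (x + y)) * ψ (-(s * y)) = ψ (s * x) := by
      rw [← AddChar.map_add_eq_mul]; congr 1; ring
    rw [← this]; ring
  rw [charSum]
  simp only [lazySymm]
  push_cast
  simp only [add_mul, Finset.sum_add_distrib]
  refine congrArg₂ (· + ·) ?_ ?_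
  · rw [Finset.sum_eq_single 0 (fun x _ hx => by rw [if_neg hx]; simp) (by simp), if_pos rfl]
    simp
  · have : ((‖charSum ψ u s‖ : ℂ)) ^ 2 = ((‖charSum ψ u s‖ ^ 2 : ℝ) : ℂ) := by push_cast; rfl
    rw [this, h1, Finset.mul_sum]
    refine Finset.sum_congr rfl fun x _ => ?_
    rw [mul_assoc, Finset.sum_mul]
    push_cast
    rfl

/-- `1 - |û(s)|²`. -/
def defect (ψ : AddChar F ℂ) (u : F → ℝ) (s : F) : ℝ := 1 - ‖charSum ψ u s‖ ^ 2

theorem norm_charSum_le_one (ψ : AddChar F ℂ) {u : F → ℝ} (hu0 : ∀ x, 0 ≤ u x)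
    (hu : ∑ x, u x = 1) (s : F) : ‖charSum ψ u s‖ ≤ 1 := by
  rw [← hu, charSum]
  refine (norm_sum_le _ _).trans (Finset.sum_le_sum fun x _ => ?_)
  rw [norm_mul, AddChar.norm_apply, mul_one, Complex.norm_real, Real.norm_eq_abs,
    abs_of_nonneg (hu0 x)]

theorem defect_nonneg (ψ : AddChar F ℂ) {u : F → ℝ} (hu0 : ∀ x, 0 ≤ u x)
    (hu : ∑ x, u x = 1) (s : F) : 0 ≤ defect ψ u s := by
  have := norm_charSum_le_one ψ hu0 hu s
  have h0 := norm_nonneg (charSum ψ u s)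
  unfold defect; nlinarith

theorem defect_le_one (ψ : AddChar F ℂ) (u : F → ℝ) (s : F) : defect ψ u s ≤ 1 := by
  unfold defect; nlinarith [sq_nonneg ‖charSum ψ u s‖]

theorem defect_eq (ψ : AddChar F ℂ) {u : F → ℝ} (hu : ∑ x, u x = 1) (s : F) :
    defect ψ u s = ∑ x, ∑ y, u x * u y * (1 - (ψ (s * (x - y))).re) := by
  have h1 : ((‖charSum ψ u s‖ ^ 2 : ℝ) : ℂ) =
      ∑ x, ∑ y, ((u x * u y : ℝ) : ℂ) * ψ (s * (x - y)) := by
    rw [← Complex.normSq_eq_norm_sq, ← Complex.mul_conj, charSum, map_sum, Finset.sum_mul_sum]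
    refine Finset.sum_congr rfl fun x _ => Finset.sum_congr rfl fun y _ => ?_
    simp only [map_mul, Complex.conj_ofReal]
    rw [← AddChar.map_neg_eq_conj]
    have : ψ (s * (x - y)) = ψ (s * x) * ψ (-(s * y)) := by
      rw [← AddChar.map_add_eq_mul]; congr 1; ring
    rw [this]; push_cast; ring
  have h2 := congrArg Complex.re h1
  simp only [Complex.ofReal_re, Complex.re_sum, Complex.re_ofReal_mul] at h2
  have h3 : ∑ x, ∑ y, u x * u y = 1 := by
    rw [← Finset.sum_mul_sum, hu, one_mul]
  simp only [mul_one_sub, Finset.sum_sub_distrib]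
  rw [h3, ← h2, defect]

theorem one_sub_re_mul_le {z w : ℂ} (hz : ‖z‖ = 1) (hw : ‖w‖ = 1) :
    1 - (z * w).re ≤ 2 * (1 - z.re) + 2 * (1 - w.re) := by
  have h1 : z.re ^ 2 + z.im ^ 2 = 1 := by
    have := Complex.sq_norm z
    rw [hz, Complex.normSq_apply] at this; nlinarith
  have h2 : w.re ^ 2 + w.im ^ 2 = 1 := by
    have := Complex.sq_norm w
    rw [hw, Complex.normSq_apply] at this; nlinarith
  rw [Complex.mul_re]
  nlinarith [sq_nonneg (z.re + w.re - 2), sq_nonneg (z.im - w.im), sq_nonneg (z.re - w.re),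
    sq_nonneg (z.im + w.im)]

theorem defect_add_le (ψ : AddChar F ℂ) {u : F → ℝ} (hu0 : ∀ x, 0 ≤ u x)
    (hu : ∑ x, u x = 1) (s t : F) :
    defect ψ u (s + t) ≤ 2 * defect ψ u s + 2 * defect ψ u t := by
  rw [defect_eq ψ hu, defect_eq ψ hu, defect_eq ψ hu, Finset.mul_sum, Finset.mul_sum,
    ← Finset.sum_add_distrib]
  refine Finset.sum_le_sum fun x _ => ?_
  rw [Finset.mul_sum, Finset.mul_sum, ← Finset.sum_add_distrib]
  refine Finset.sum_le_sum fun y _ => ?_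
  have h1 := one_sub_re_mul_le (AddChar.norm_apply ψ (s * (x - y)))
    (AddChar.norm_apply ψ (t * (x - y)))
  rw [← AddChar.map_add_eq_mul, ← add_mul] at h1
  have h2 := mul_le_mul_of_nonneg_left h1 (mul_nonneg (hu0 x) (hu0 y))
  linarith

theorem defect_neg (ψ : AddChar F ℂ) {u : F → ℝ}
    (hu : ∑ x, u x = 1) (s : F) : defect ψ u (-s) = defect ψ u s := by
  rw [defect_eq ψ hu, defect_eq ψ hu]
  refine Finset.sum_congr rfl fun x _ => Finset.sum_congr rfl fun y _ => ?_
  rw [neg_mul, AddChar.map_neg_eq_conj, Complex.conj_re]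

/-- On average over a group of frequencies, a balanced measure has defect at least `α`. -/
theorem card_mul_le_sum_defect {G : Type*} [AddCommGroup G] [Fintype G] {ψ : AddChar F ℂ}
    (hψ : ψ.IsPrimitive) {α : ℝ} {u : F → ℝ} (hu : IsBalanced α u) (f : G →+ F) (hf : f ≠ 0) :
    α * Fintype.card G ≤ ∑ ξ, defect ψ u (f ξ) := by
  obtain ⟨hu0, hu1, hu2⟩ := hu
  let Ann : AddSubgroup F :=
    { carrier := {z | ∀ ξ, ψ (f ξ * z) = 1}
      zero_mem' := by intro ξ; simp
      add_mem' := by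
        intro a b ha hb ξ
        rw [mul_add, AddChar.map_add_eq_mul, ha ξ, hb ξ, one_mul]
      neg_mem' := by
        intro a ha ξ
        rw [mul_neg, AddChar.map_neg_eq_inv, ha ξ, inv_one] }
  have hAnn : Ann ≠ ⊤ := by
    intro h
    refine hf ?_
    ext ξ
    by_contra hne
    refine hψ (a := f ξ) hne ?_
    ext t
    have : t ∈ Ann := h ▸ AddSubgroup.mem_top t
    simpa [AddChar.mulShift_apply] using this ξ
  have hsum : ∀ z : F, ∑ ξ, (1 - (ψ (f ξ * z)).re) =
      if z ∈ Ann then 0 else (Fintype.card G : ℝ) := by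
    intro z
    let χ : AddChar G ℂ :=
      { toFun := fun ξ => ψ (f ξ * z)
        map_zero_eq_one' := by simp
        map_add_eq_mul' := by intro a b; simp [add_mul, AddChar.map_add_eq_mul] }
    have h1 := AddChar.sum_eq_ite χ
    have h2 : χ = 0 ↔ z ∈ Ann := by
      rw [DFunLike.ext_iff]
      rfl
    have h3 := congrArg Complex.re h1
    rw [Complex.re_sum] at h3
    have h4 : ∑ ξ, (χ ξ).re = ∑ ξ, (ψ (f ξ * z)).re := rfl
    rw [Finset.sum_sub_distrib, ← h4, h3]
    simp only [h2]
    split_ifs <;> simp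
  simp only [defect_eq ψ hu1]
  rw [Finset.sum_comm]
  have hx : ∀ x, ∑ ξ, ∑ y, u x * u y * (1 - (ψ (f ξ * (x - y))).re) =
      u x * (Fintype.card G * (1 - ∑ y ∈ Finset.univ.filter (fun y => y - x ∈ Ann), u y)) := by
    intro x
    rw [Finset.sum_comm]
    simp only [← Finset.mul_sum, hsum, mul_assoc]
    congr 1
    rw [← hu1, Finset.sum_filter, ← Finset.sum_sub_distrib, Finset.mul_sum]
    refine Finset.sum_congr rfl fun y _ => ?_
    have : x - y ∈ Ann ↔ y - x ∈ Ann := by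
      rw [← neg_sub, neg_mem_iff]
    simp only [this]
    split_ifs <;> ring
  simp only [hx]
  calc α * Fintype.card G = ∑ x, u x * (Fintype.card G * α) := by
        rw [← Finset.sum_mul, hu1]; ring
    _ ≤ _ := by
      refine Finset.sum_le_sum fun x _ => ?_
      have := hu2 x Ann hAnn
      have h0 := hu0 x
      gcongr
      linarith

/-- The Halász-type inequality: the bias of a product measure on a subspace without sparse
normal vectors is much smaller than the mass given to it by the lazy symmetrization. -/
theorem bias_le_lazySymm_mass {ψ : AddChar F ℂ} (hψ : ψ.IsPrimitive) {α : ℝ} (hα : 0 ≤ α)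
    {u : ι → F → ℝ} (hu : ∀ j, IsBalanced α (u j)) (V : Submodule F (ι → F)) (s m : ℕ)
    (hs : ∀ ξ ∈ perp V, ξ ≠ 0 → s ≤ (Finset.univ.filter (fun j => ξ j ≠ 0)).card) :
    bias ψ u V ≤ (2 / 3) ^ m *
        submoduleMass (prodWeight (fun j => lazySymm (4 ^ (m + 1))⁻¹ (u j))) V +
      Real.exp (-(α * s / (2 * 4 ^ m))) := by
  set β : ℝ := (4 ^ (m + 1))⁻¹ with hβ
  have h4 : (1 : ℝ) ≤ 4 ^ m := one_le_pow₀ (by norm_num)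
  have hβ0 : 0 < β := by positivity
  have hβ1 : β ≤ 1 / 4 := by
    rw [hβ, pow_succ, one_div]
    apply inv_anti₀ (by norm_num); linarith
  set h : perp V → ℝ := fun ξ => ∑ j, defect ψ (u j) (ξ.1 j) with hh
  have hc : (0 : ℝ) < Fintype.card (perp V) := by exact_mod_cast Fintype.card_pos
  have hd0 := fun j => defect_nonneg ψ (hu j).1 (hu j).2.1
  have key := sum_exp_neg_half_le h (α * s) (by simp [hh, defect, charSum_zero ψ (hu _).2.1])
    (fun ξ => Finset.sum_nonneg fun j _ => hd0 j _)
    (fun ξ => Finset.sum_congr rfl fun j _ => by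
      simpa using defect_neg ψ (hu j).2.1 (ξ.1 j))
    (fun ξ ξ' => by
      simp only [hh]
      rw [Finset.mul_sum, Finset.mul_sum, ← Finset.sum_add_distrib]
      exact Finset.sum_le_sum fun j _ => defect_add_le ψ (hu j).1 (hu j).2.1 _ _) (by
      intro H hH
      by_contra hcon
      push Not at hcon
      obtain ⟨ξ₀, hξ₀, hne⟩ := AddSubgroup.ne_bot_iff_exists_ne_zero.1 hH |>.elim
        fun a ha => (⟨a.1, a.2, fun hz => ha (Subtype.ext hz)⟩ : ∃ ξ, ∃ _ : ξ ∈ H, ξ ≠ 0)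
      have hs' := hs ξ₀.1 ξ₀.2 (fun hz => hne (Subtype.ext hz))
      have h1 : ∑ ξ : H, h ξ.1 < ∑ _ξ : H, α * s :=
        Finset.sum_lt_sum_of_nonempty ⟨0, Finset.mem_univ _⟩ fun ξ _ => hcon _ ξ.2
      simp only [hh] at h1
      rw [Finset.sum_comm] at h1
      have h2 : ∑ j ∈ Finset.univ.filter (fun j => ξ₀.1 j ≠ 0), α * Fintype.card H ≤
          ∑ j, ∑ ξ : H, defect ψ (u j) (ξ.1.1 j) := by
        refine (Finset.sum_le_sum fun j hj => ?_).trans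
          (Finset.sum_le_univ_sum_of_nonneg fun j => Finset.sum_nonneg fun ξ _ => hd0 j _)
        let f : H →+ F :=
          { toFun := fun ξ => ξ.1.1 j
            map_zero' := by simp
            map_add' := by intro a b; simp }
        refine card_mul_le_sum_defect hψ (hu j) f ?_
        intro hf
        have := DFunLike.congr_fun hf ⟨ξ₀, hξ₀⟩
        exact (Finset.mem_filter.1 hj).2 this
      rw [Finset.sum_const, nsmul_eq_mul] at h2
      simp only [Finset.sum_const, nsmul_eq_mul, Finset.card_univ] at h1
      have h3 : (s : ℝ) ≤ (Finset.univ.filter (fun j => ξ₀.1 j ≠ 0)).card := by exact_mod_cast hs'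
      have h5 : (s : ℝ) * (α * Fintype.card H) ≤
        (Finset.univ.filter (fun j => ξ₀.1 j ≠ 0)).card * (α * Fintype.card H) := by gcongr
      nlinarith) m
  have hf : ∀ ξ : perp V, ∏ j, ‖charSum ψ (u j) (ξ.1 j)‖ ≤ Real.exp (-(h ξ / 2)) := by
    intro ξ
    simp only [hh]
    rw [← neg_div, ← Finset.sum_neg_distrib, Finset.sum_div, Real.exp_sum]
    refine Finset.prod_le_prod (fun j _ => norm_nonneg _) fun j _ => ?_
    refine le_of_sq_le_sq ?_ (Real.exp_pos _).le
    rw [← Real.exp_nat_mul]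
    have := Real.add_one_le_exp (-defect ψ (u j) (ξ.1 j))
    have e : ((2 : ℕ) : ℝ) * (-defect ψ (u j) (ξ.1 j) / 2) = -defect ψ (u j) (ξ.1 j) := by
      push_cast; ring
    rw [e]
    refine le_trans ?_ this
    unfold defect; linarith
  have hg : ∀ ξ : perp V, Real.exp (-(h ξ / (2 * 4 ^ m))) ≤
      ∏ j, (1 - β + β * ‖charSum ψ (u j) (ξ.1 j)‖ ^ 2) := by
    intro ξ
    simp only [hh]
    rw [← neg_div, ← Finset.sum_neg_distrib, Finset.sum_div, Real.exp_sum]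
    refine Finset.prod_le_prod (fun j _ => (Real.exp_pos _).le) fun j _ => ?_
    have hd1 := defect_le_one ψ (u j) (ξ.1 j)
    have hd := hd0 j (ξ.1 j)
    set D := defect ψ (u j) (ξ.1 j) with hD
    have e1 : -D / (2 * 4 ^ m) = -(2 * (β * D)) := by
      rw [hβ, pow_succ]; field_simp; ring
    have e2 : 1 - β + β * ‖charSum ψ (u j) (ξ.1 j)‖ ^ 2 = 1 - β * D := by
      rw [hD, defect]; ring
    rw [e1, e2, Real.exp_neg]
    have hy0 : 0 ≤ β * D := by positivity
    have hy1 : β * D ≤ 1 / 4 := by nlinarith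
    have := Real.add_one_le_exp (2 * (β * D))
    rw [inv_le_iff_one_le_mul₀ (Real.exp_pos _)]
    nlinarith
  have hmass : submoduleMass (prodWeight (fun j => lazySymm β (u j))) V =
      (Fintype.card (perp V) : ℝ)⁻¹ *
        ∑ ξ : perp V, ∏ j, (1 - β + β * ‖charSum ψ (u j) (ξ.1 j)‖ ^ 2) := by
    have := card_perp_mul_submoduleMass hψ V (fun j => lazySymm β (u j))
    simp only [charSum_lazySymm, ← Complex.ofReal_prod, ← Complex.ofReal_sum] at this
    have h' : (Fintype.card (perp V) : ℝ) *
        submoduleMass (prodWeight (fun j => lazySymm β (u j))) V =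
        ∑ ξ : perp V, ∏ j, (1 - β + β * ‖charSum ψ (u j) (ξ.1 j)‖ ^ 2) := by
      exact_mod_cast this
    rw [← h']; field_simp
  rw [hmass, bias]
  have hfin : ∑ ξ ∈ Finset.univ.filter (fun ξ : perp V => ξ ≠ 0),
      Real.exp (-(h ξ / (2 * 4 ^ m))) ≤
        ∑ ξ : perp V, ∏ j, (1 - β + β * ‖charSum ψ (u j) (ξ.1 j)‖ ^ 2) :=
    (Finset.sum_le_sum fun ξ _ => hg ξ).trans (Finset.sum_le_univ_sum_of_nonneg fun ξ =>
      (Real.exp_pos _).le.trans (hg ξ))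
  calc _ ≤ (Fintype.card (perp V) : ℝ)⁻¹ *
        ((2 / 3) ^ m * ∑ ξ : perp V, ∏ j, (1 - β + β * ‖charSum ψ (u j) (ξ.1 j)‖ ^ 2) +
          Fintype.card (perp V) * Real.exp (-(α * s / (2 * 4 ^ m)))) := by
        gcongr
        refine (Finset.sum_le_sum fun ξ _ => hf ξ).trans (key.trans ?_)
        gcongr
    _ = _ := by field_simp

end Fourier

theorem sum_prodWeight_mul_restrict {κ E : Type*} [Fintype κ] [DecidableEq κ] [Fintype E] (S : κ → Prop)
    [DecidablePred S]
    (u : κ → E → ℝ) (G : ({a // S a} → E) → ℝ) :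
    ∑ x, prodWeight u x * G (fun a => x a) =
      (∑ z, prodWeight (fun a : {a // S a} => u a) z * G z) *
        ∏ a : {a // ¬ S a}, ∑ z, u a z := by
  rw [← sum_prodWeight (fun a : {a // ¬ S a} => u a), Finset.sum_mul_sum,
    ← Fintype.sum_prod_type', ← Equiv.sum_comp (Equiv.piEquivPiSubtypeProd S (fun _ => E))]
  refine Finset.sum_congr rfl fun x _ => ?_
  have : prodWeight u x = prodWeight (fun a : {a // S a} => u a) (fun a => x a) *
      prodWeight (fun a : {a // ¬ S a} => u a) (fun a => x a) :=
    (Fintype.prod_subtype_mul_prod_subtype S (fun a => u a (x a))).symm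
  rw [this]
  simp only [Equiv.piEquivPiSubtypeProd, Equiv.coe_fn_mk]
  ring

/-- Coordinates outside `S` are independent of a function of the coordinates in `S`. -/
theorem sum_prodWeight_mul_of_mem_submodule {F κ E : Type*} [Field F] [AddCommGroup E]
    [Module F E] [Fintype κ] [DecidableEq κ] [Fintype E] (S : κ → Prop)
    [DecidablePred S]
    {u : κ → E → ℝ} (hu1 : ∀ a, ∑ z, u a z = 1) (V : Submodule F E)
    (G : ({a // S a} → E) → ℝ) :
    ∑ x, prodWeight u x * ((if ∀ a, ¬ S a → x a ∈ V then 1 else 0) * G (fun a => x a)) =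
      (∏ a : {a // ¬ S a}, submoduleMass (u a) V) * ∑ x, prodWeight u x * G (fun a => x a) := by
  have h1 : ∀ x : κ → E, prodWeight u x *
      ((if ∀ a, ¬ S a → x a ∈ V then 1 else 0) * G (fun a => x a)) =
      prodWeight (fun a z => if S a then u a z else if z ∈ V then u a z else 0) x *
        G (fun a => x a) := by
    intro x
    rw [← mul_assoc]
    congr 1
    unfold prodWeight
    split_ifs with h
    · rw [mul_one]
      refine Finset.prod_congr rfl fun a _ => ?_
      by_cases hS : S a
      · simp [hS]
      · simp [hS, h a hS]
    · push Not at h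
      obtain ⟨a, ha, haV⟩ := h
      rw [mul_zero, Finset.prod_eq_zero (Finset.mem_univ a)]
      simp [ha, haV]
  simp only [h1]
  rw [sum_prodWeight_mul_restrict, sum_prodWeight_mul_restrict]
  have h2 : ∀ a : {a // ¬ S a}, (∑ z, if S a then u a z else if z ∈ V then u a z else 0) =
      submoduleMass (u a) V := by
    intro a
    simp [a.2, submoduleMass, Finset.sum_filter]
  have h3 : ∀ z : {a // S a} → E, prodWeight (fun (a : {a // S a}) z =>
      if S a then u a z else if z ∈ V then u a z else 0) z =
      prodWeight (fun a : {a // S a} => u a) z := by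
    intro z
    simp only [prodWeight]
    refine Finset.prod_congr rfl fun a _ => ?_
    simp [a.2]
  simp only [h2, h3, hu1, Finset.prod_const_one, mul_one]
  ring

/-- Resampling one coordinate. -/
theorem sum_prodWeight_mem_le {F κ E : Type*} [Field F] [AddCommGroup E]
    [Module F E] [Fintype κ] [DecidableEq κ] [Fintype E] {u : κ → E → ℝ} (hu : ∀ a z, 0 ≤ u a z) (j : κ)
    (U : (κ → E) → Submodule F E) (hU : ∀ x y, (∀ a, a ≠ j → x a = y a) → U x = U y) (B : ℝ)
    (hB : ∀ x, submoduleMass (u j) (U x) ≤ B) :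
    ∑ x ∈ Finset.univ.filter (fun x => x j ∈ U x), prodWeight u x ≤
      (∏ a : {a // a ≠ j}, ∑ z, u a.1 z) * B := by
  rw [Finset.sum_filter, ← Equiv.sum_comp (Equiv.funSplitAt j E).symm, Fintype.sum_prod_type_right,
    ← sum_prodWeight (fun a : {a // a ≠ j} => u a), Finset.sum_mul]
  refine Finset.sum_le_sum fun w _ => ?_
  have h1 : ∀ z, prodWeight u ((Equiv.funSplitAt j E).symm (z, w)) =
      prodWeight (fun a : {a // a ≠ j} => u a) w * u j z := by
    intro z
    rw [prodWeight, Fintype.prod_eq_mul_prod_subtype_ne _ j, mul_comm]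
    congr 1
    · refine Finset.prod_congr rfl fun a _ => ?_
      simp [Equiv.funSplitAt, Equiv.piSplitAt, a.2]
    · simp [Equiv.funSplitAt, Equiv.piSplitAt]
  have h2 : ∀ z, U ((Equiv.funSplitAt j E).symm (z, w)) =
      U ((Equiv.funSplitAt j E).symm (0, w)) := by
    intro z
    apply hU
    intro a ha
    simp [Equiv.funSplitAt, Equiv.piSplitAt, ha]
  have h3 : ∀ z, (Equiv.funSplitAt j E).symm (z, w) j = z := by
    intro z; simp [Equiv.funSplitAt, Equiv.piSplitAt]
  simp only [h1, h2, h3]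
  have := hB ((Equiv.funSplitAt j E).symm (0, w))
  rw [submoduleMass, Finset.sum_filter] at this
  calc _ = prodWeight (fun a : {a // a ≠ j} => u a) w *
        ∑ z, if z ∈ U ((Equiv.funSplitAt j E).symm (0, w)) then u j z else 0 := by
        rw [Finset.mul_sum]
        refine Finset.sum_congr rfl fun z _ => ?_
        split_ifs <;> simp
    _ ≤ _ := mul_le_mul_of_nonneg_left this (prodWeight_nonneg (u := fun a : {a // a ≠ j} => u a) (fun a => hu a) w)

/-- A subspace of codimension `d` has mass at most `θ ^ d` under a product of measures with
atoms at most `θ`. -/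
theorem submoduleMass_prodWeight_le {F ι : Type*} [Field F] [Fintype F] [Fintype ι] [DecidableEq ι]
    {u : ι → F → ℝ} (hu0 : ∀ j x, 0 ≤ u j x) (hu1 : ∀ j, ∑ x, u j x = 1) {θ : ℝ}
    (hθ : ∀ j x, u j x ≤ θ) (V : Submodule F (ι → F)) :
    submoduleMass (prodWeight u) V ≤ θ ^ (Fintype.card ι - Module.finrank F V) := by
  obtain ⟨κ, a, ha, hspan, hli⟩ := exists_linearIndependent' F
    (fun j : ι => V.mkQ (Pi.single j (1 : F)))
  have hfin : Finite κ := Finite.of_injective a ha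
  have := Fintype.ofFinite κ
  have htop : Submodule.span F (Set.range (fun j : ι => V.mkQ (Pi.single j (1 : F)))) = ⊤ := by
    have h1 : Submodule.span F (Set.range (fun j : ι => (Pi.single j (1 : F) : ι → F))) = ⊤ := by
      have := (Pi.basisFun F ι).span_eq
      convert this using 3
      ext j; simp
    have h2 : Set.range (fun j : ι => V.mkQ (Pi.single j (1 : F))) =
        V.mkQ '' Set.range (fun j : ι => (Pi.single j (1 : F) : ι → F)) := by
      rw [← Set.range_comp]; rfl
    rw [h2, Submodule.span_image, h1, Submodule.map_top, Submodule.range_mkQ]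
  have hcard : Fintype.card κ = Fintype.card ι - Module.finrank F V := by
    rw [← finrank_span_eq_card hli, hspan, htop, finrank_top]
    have := Submodule.finrank_quotient_add_finrank V
    rw [Module.finrank_fintype_fun_eq_card] at this
    omega
  set J : Finset ι := Finset.univ.image a with hJ
  have hJc : J.card = Fintype.card κ := Finset.card_image_of_injective _ ha
  have hinj : ∀ x ∈ V, ∀ y ∈ V, (∀ j, j ∉ J → x j = y j) → x = y := by
    intro x hx y hy h
    have h1 : x - y = ∑ i : κ, (x - y) (a i) • (Pi.single (a i) (1 : F) : ι → F) := by
      ext j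
      rw [Finset.sum_apply]
      by_cases hj : j ∈ J
      · obtain ⟨i, _, rfl⟩ := Finset.mem_image.1 hj
        rw [Finset.sum_eq_single i]
        · simp
        · intro b _ hb
          have : a i ≠ a b := fun h => hb (ha h).symm
          simp [this]
        · simp
      · rw [Finset.sum_eq_zero]
        · simp [h j hj]
        · intro b _
          have : j ≠ a b := fun h => hj (h ▸ Finset.mem_image_of_mem a (Finset.mem_univ b))
          simp [this]
    have h2 : ∑ i : κ, (x - y) (a i) • V.mkQ (Pi.single (a i) (1 : F)) = 0 := by
      simp only [← map_smul]
      rw [← map_sum, ← h1]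
      exact (Submodule.Quotient.mk_eq_zero V).2 (V.sub_mem hx hy)
    have h3 := Fintype.linearIndependent_iff.1 hli _ h2
    have h4 : x - y = 0 := by
      rw [h1]
      exact Finset.sum_eq_zero fun i _ => by rw [h3 i, zero_smul]
    exact sub_eq_zero.1 h4
  rw [← hcard, ← hJc, submoduleMass]
  have hθ0 : ∀ j : ι, 0 ≤ θ := fun j => (hu0 j 0).trans (hθ j 0)
  have hsplit : ∀ x : ι → F, prodWeight u x ≤ θ ^ J.card *
      prodWeight (fun j : {j // j ∉ J} => u j) (fun j => x j) := by
    intro x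
    have h1 : prodWeight u x = (∏ j ∈ J, u j (x j)) *
        prodWeight (fun j : {j // j ∉ J} => u j) (fun j => x j) := by
      rw [prodWeight, ← Fintype.prod_subtype_mul_prod_subtype (fun j => j ∈ J)]
      congr 1
      exact (Finset.prod_subtype J (fun _ => Iff.rfl) (fun j => u j (x j))).symm
    rw [h1]
    refine mul_le_mul_of_nonneg_right ?_ (prodWeight_nonneg (u := fun j : {j // j ∉ J} => u j) (fun j => hu0 j) _)
    refine (Finset.prod_le_prod (fun j _ => hu0 j _) (fun j _ => hθ j (x j))).trans ?_
    rw [Finset.prod_const]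
  calc _ ≤ ∑ x ∈ Finset.univ.filter (fun x => x ∈ V), θ ^ J.card *
        prodWeight (fun j : {j // j ∉ J} => u j) (fun j => x j) :=
        Finset.sum_le_sum fun x _ => hsplit x
    _ = θ ^ J.card * ∑ x ∈ Finset.univ.filter (fun x => x ∈ V),
        prodWeight (fun j : {j // j ∉ J} => u j) (fun j => x j) := by rw [Finset.mul_sum]
    _ = θ ^ J.card * ∑ z ∈ (Finset.univ.filter (fun x => x ∈ V)).image
          (fun x (j : {j // j ∉ J}) => x j),
        prodWeight (fun j : {j // j ∉ J} => u j) z := by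
        rw [Finset.sum_image]
        intro x hx y hy h
        simp only [Finset.coe_filter, Finset.mem_univ, true_and, Set.mem_ofPred_eq] at hx hy
        exact hinj x hx y hy fun j hj => congrFun h ⟨j, hj⟩
    _ ≤ θ ^ J.card * ∑ z, prodWeight (fun j : {j // j ∉ J} => u j) z := by
        refine mul_le_mul_of_nonneg_left ?_ ?_
        · exact Finset.sum_le_univ_sum_of_nonneg fun z => prodWeight_nonneg (u := fun j : {j // j ∉ J} => u j) (fun j => hu0 j) z
        · rcases J.eq_empty_or_nonempty with h | ⟨j, _⟩
          · simp [h]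
          · exact pow_nonneg (hθ0 j) _
    _ = θ ^ J.card := by
        rw [sum_prodWeight (fun j : {j // j ∉ J} => u j)]; simp [hu1]

/-- Bound for the probability that independent random vectors are linearly dependent. -/
theorem sum_prodWeight_not_linearIndependent_le {F κ E : Type*} [Field F] [AddCommGroup E]
    [Module F E] [Module.Finite F E] [Fintype κ] [DecidableEq κ] [Fintype E] {u : κ → E → ℝ}
    (hu : ∀ a z, 0 ≤ u a z) (B : ℝ)
    (hB : ∀ (j : κ) (U : Submodule F E), Module.finrank F U + 1 ≤ Fintype.card κ →
      submoduleMass (u j) U ≤ B) :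
    ∑ x ∈ Finset.univ.filter (fun x : κ → E => ¬ LinearIndependent F x), prodWeight u x ≤
      ∑ j, (∏ a : {a // a ≠ j}, ∑ z, u a.1 z) * B := by
  have h1 : ∀ j : κ, ∑ x ∈ Finset.univ.filter
      (fun x : κ → E => x j ∈ Submodule.span F (x '' (Set.univ \ {j}))), prodWeight u x ≤
      (∏ a : {a // a ≠ j}, ∑ z, u a.1 z) * B := by
    intro j
    refine sum_prodWeight_mem_le hu j (fun x => Submodule.span F (x '' (Set.univ \ {j})))
      ?_ B ?_
    · intro x y h
      congr 1
      exact Set.image_congr fun a ha => h a (by simpa using ha)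
    · intro x
      apply hB
      have h2 : x '' (Set.univ \ {j}) = ((Finset.univ.erase j).image x : Finset E) := by
        ext; simp
      rw [h2]
      have h3 := finrank_span_finset_le_card (R := F) ((Finset.univ.erase j).image x)
      have h4 := Finset.card_image_le (s := Finset.univ.erase j) (f := x)
      rw [Finset.card_erase_of_mem (Finset.mem_univ j), Finset.card_univ] at h4
      have h5 : 0 < Fintype.card κ := Fintype.card_pos_iff.2 ⟨j⟩
      have h6 := h3.trans h4
      change Module.finrank F _ ≤ _ at h6
      omega
  refine le_trans ?_ (Finset.sum_le_sum fun j _ => h1 j)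
  simp only [Finset.sum_filter]
  rw [Finset.sum_comm]
  refine Finset.sum_le_sum fun x _ => ?_
  have h0 := prodWeight_nonneg hu x
  by_cases h : LinearIndependent F x
  · rw [if_neg (not_not.2 h)]
    refine Finset.sum_nonneg fun j _ => ?_
    split_ifs <;> simp [h0]
  · rw [if_pos h]
    rw [linearIndependent_iff_notMem_span] at h
    push Not at h
    obtain ⟨j, hj⟩ := h
    refine le_trans ?_ (Finset.single_le_sum
      (f := fun j => if x j ∈ Submodule.span F (x '' (Set.univ \ {j})) then prodWeight u x else 0)
      (fun j _ => ?_) (Finset.mem_univ j))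
    · simp only [hj, if_true, le_refl]
    · split_ifs <;> simp [h0]

/-- The weight of the linearly independent families whose span belongs to `S`. -/
def indepMass {F κ E : Type*} [Field F] [AddCommGroup E] [Module F E] [Fintype κ]
    [DecidableEq κ] [Fintype E] (u : κ → E → ℝ) (S : Set (Submodule F E)) : ℝ :=
  ∑ x ∈ Finset.univ.filter (fun x : κ → E =>
    LinearIndependent F x ∧ Submodule.span F (Set.range x) ∈ S), prodWeight u x

section IndepMass

variable {F κ E : Type*} [Field F] [AddCommGroup E] [Module F E] [Fintype κ] [DecidableEq κ]
  [Fintype E]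

theorem indepMass_nonneg {u : κ → E → ℝ} (hu : ∀ a z, 0 ≤ u a z) (S : Set (Submodule F E)) :
    0 ≤ indepMass u S := Finset.sum_nonneg fun x _ => prodWeight_nonneg hu x

theorem indepMass_le_one {u : κ → E → ℝ} (hu : ∀ a z, 0 ≤ u a z) (hu1 : ∀ a, ∑ z, u a z = 1)
    (S : Set (Submodule F E)) : indepMass u S ≤ 1 := by
  refine (Finset.sum_le_univ_sum_of_nonneg fun x => prodWeight_nonneg hu x).trans ?_
  rw [sum_prodWeight]; simp [hu1]

theorem indepMass_mono_of_subset_union {u : κ → E → ℝ} (hu : ∀ a z, 0 ≤ u a z)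
    {S A B C : Set (Submodule F E)}
    (h : ∀ V ∈ S, Module.finrank F V = Fintype.card κ → V ∈ A ∨ V ∈ B ∨ V ∈ C) :
    indepMass u S ≤ indepMass u A + indepMass u B + indepMass u C := by
  simp only [indepMass, Finset.sum_filter, ← Finset.sum_add_distrib]
  refine Finset.sum_le_sum fun x _ => ?_
  have h0 := prodWeight_nonneg hu x
  by_cases hx : LinearIndependent F x
  · simp only [hx, true_and]
    have := h (Submodule.span F (Set.range x))
    rw [finrank_span_eq_card hx] at this
    by_cases hS : Submodule.span F (Set.range x) ∈ S
    · rw [if_pos hS]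
      rcases this hS rfl with h | h | h <;> rw [if_pos h] <;> split_ifs <;> linarith
    · rw [if_neg hS]
      split_ifs <;> linarith
  · simp [hx]

end IndepMass

/-- Adding one more random vector to a linearly independent family. -/
theorem abs_indepMass_succ_sub_le {F E : Type*} [Field F] [AddCommGroup E] [Module F E]
    [Fintype E] {k : ℕ} {u : ℕ → E → ℝ} (hu : ∀ a z, 0 ≤ u a z) (hu1 : ∀ a, ∑ z, u a z = 1)
    {t δ : ℝ} (ht0 : 0 ≤ t) (ht1 : t ≤ 1) (hδ : 0 ≤ δ) (S : Set (Submodule F E))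
    (hS : ∀ V, V ∉ S → Module.finrank F V = k → |submoduleMass (u k) V - t| ≤ δ) :
    |indepMass (F := F) (fun i : Fin (k + 1) => u i) Set.univ -
      indepMass (F := F) (fun i : Fin k => u i) Set.univ * (1 - t)| ≤
      δ + indepMass (fun i : Fin k => u i) S := by
  have h1 : indepMass (F := F) (fun i : Fin (k + 1) => u i) Set.univ =
      ∑ x ∈ Finset.univ.filter (fun x : Fin k → E => LinearIndependent F x),
        prodWeight (fun i : Fin k => u i) x *
          (1 - submoduleMass (u k) (Submodule.span F (Set.range x))) := by
    rw [indepMass, Finset.sum_filter, ← Equiv.sum_comp (Fin.snocEquiv (fun _ => E)),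
      Fintype.sum_prod_type_right, Finset.sum_filter]
    refine Finset.sum_congr rfl fun x _ => ?_
    have e1 : ∀ z : E, prodWeight (fun i : Fin (k + 1) => u i)
        ((Fin.snocEquiv (fun _ => E)) (z, x)) = prodWeight (fun i : Fin k => u i) x * u k z := by
      intro z
      simp [prodWeight, Fin.prod_univ_castSucc, Fin.snocEquiv]
    have e2 : ∀ z : E, LinearIndependent F ((Fin.snocEquiv (fun _ => E)) (z, x)) ↔
        LinearIndependent F x ∧ z ∉ Submodule.span F (Set.range x) := by
      intro z
      exact linearIndependent_finSnoc
    simp only [e1, e2, Set.mem_univ, and_true]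
    by_cases hx : LinearIndependent F x
    · simp only [hx, true_and, if_true]
      rw [submoduleMass, Finset.sum_filter, ← hu1 k, ← Finset.sum_sub_distrib, Finset.mul_sum]
      refine Finset.sum_congr rfl fun z _ => ?_
      split_ifs <;> ring
    · simp [hx]
  rw [h1, indepMass, Finset.sum_mul]
  simp only [Set.mem_univ, and_true]
  rw [← Finset.sum_sub_distrib]
  refine (Finset.abs_sum_le_sum_abs _ _).trans ?_
  have h2 : δ = ∑ x : Fin k → E, prodWeight (fun i : Fin k => u i) x * δ := by
    rw [← Finset.sum_mul, sum_prodWeight]; simp [hu1]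
  have h3 : ∑ x ∈ Finset.univ.filter (fun x : Fin k → E => LinearIndependent F x),
      prodWeight (fun i : Fin k => u i) x * δ ≤ δ := by
    conv_rhs => rw [h2]
    exact Finset.sum_le_univ_sum_of_nonneg fun x =>
      mul_nonneg (prodWeight_nonneg (u := fun i : Fin k => u i) (fun a => hu a) x) hδ
  refine le_trans ?_ (add_le_add_left h3 _)
  rw [indepMass, ← Finset.filter_filter, Finset.sum_filter (fun x : Fin k → E =>
    Submodule.span F (Set.range x) ∈ S), ← Finset.sum_add_distrib]
  refine Finset.sum_le_sum fun x hx => ?_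
  have hx : LinearIndependent F x := (Finset.mem_filter.1 hx).2
  have hp := prodWeight_nonneg (u := fun i : Fin k => u i) (fun a => hu a) x
  rw [← mul_sub, abs_mul, abs_of_nonneg hp]
  set V := Submodule.span F (Set.range x) with hV
  have hVk : Module.finrank F V = k := by rw [hV, finrank_span_eq_card hx, Fintype.card_fin]
  have hm0 := submoduleMass_nonneg (hu k) V
  have hm1 : submoduleMass (u k) V ≤ 1 := by
    rw [← hu1 k]
    exact Finset.sum_le_univ_sum_of_nonneg (hu k)
  split_ifs with hVS
  · have : |1 - submoduleMass (u k) V - (1 - t)| ≤ 1 := by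
      rw [abs_le]; constructor <;> linarith
    nlinarith [mul_nonneg hp hδ]
  · have := hS V hVS hVk
    rw [add_zero]
    refine mul_le_mul_of_nonneg_left ?_ hp
    rwa [show 1 - submoduleMass (u k) V - (1 - t) = -(submoduleMass (u k) V - t) by ring, abs_neg]

/-- The probability that a random matrix is annihilated by a nonzero vector with at most `s`
nonzero coordinates. -/
theorem sum_prodWeight_sparse_le {F κ ι : Type*} [Field F] [Fintype F] [Fintype κ] [DecidableEq κ]
    [Fintype ι] [DecidableEq ι] {u : κ → ι → F → ℝ} (hu0 : ∀ a j x, 0 ≤ u a j x)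
    (hu1 : ∀ a j, ∑ x, u a j x = 1) {θ : ℝ} (hθ0 : 0 ≤ θ) (hθ1 : θ ≤ 1)
    (hθ : ∀ a j x, u a j x ≤ θ) (s : ℕ) (hs : s ≤ Fintype.card ι) :
    ∑ x ∈ Finset.univ.filter (fun x : κ → ι → F => ∃ ξ : ι → F, ξ ≠ 0 ∧
      (Finset.univ.filter (fun j => ξ j ≠ 0)).card ≤ s ∧ ∀ a, x a ⬝ᵥ ξ = 0),
        prodWeight (fun a => prodWeight (u a)) x ≤
      (Fintype.card ι).choose s * s * θ ^ (Fintype.card κ - s) := by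
  have hprod : ∀ x : κ → ι → F, prodWeight (fun a => prodWeight (u a)) x =
      prodWeight (fun j => prodWeight (fun a => u a j)) (fun j a => x a j) := by
    intro x
    simp only [prodWeight]
    exact Finset.prod_comm
  have hone : ∀ (T : Finset ι) (t : ι), T.card = s → t ∈ T →
      ∑ c ∈ Finset.univ.filter (fun c : ι → κ → F => c t ∈ Submodule.span F (c '' (T.erase t))),
        prodWeight (fun j => prodWeight (fun a => u a j)) c ≤ θ ^ (Fintype.card κ - s) := by
    intro T t hT ht
    have := sum_prodWeight_mem_le (F := F) (u := fun j => prodWeight (fun a => u a j))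
      (fun j z => prodWeight_nonneg (fun a => hu0 a j) z) t
      (fun c => Submodule.span F (c '' (T.erase t))) (by
        intro x y h
        congr 1
        exact Set.image_congr fun a ha => h a (Finset.ne_of_mem_erase ha))
      (θ ^ (Fintype.card κ - s)) (by
        intro c
        refine (submoduleMass_prodWeight_le (fun a => hu0 a t) (fun a => hu1 a t)
          (fun a => hθ a t) _).trans ?_
        refine pow_le_pow_of_le_one hθ0 hθ1 ?_
        have h3 := finrank_span_finset_le_card (R := F) ((T.erase t).image c)
        have h4 := Finset.card_image_le (s := T.erase t) (f := c)
        rw [Finset.coe_image] at h3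
        rw [Finset.card_erase_of_mem ht] at h4
        have h6 := h3.trans h4
        change Module.finrank F _ ≤ _ at h6
        omega)
    refine this.trans (le_of_eq ?_)
    simp only [sum_prodWeight, hu1, Finset.prod_const_one, one_mul]
  have hcover : ∀ x : κ → ι → F, (∃ ξ : ι → F, ξ ≠ 0 ∧
      (Finset.univ.filter (fun j => ξ j ≠ 0)).card ≤ s ∧ ∀ a, x a ⬝ᵥ ξ = 0) →
      ∃ T ∈ Finset.powersetCard s (Finset.univ : Finset ι), ∃ t ∈ T,
        (fun a => x a t) ∈ Submodule.span F ((fun j a => x a j) '' (T.erase t)) := by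
    rintro x ⟨ξ, hξ, hcard, h0⟩
    obtain ⟨T, hsub, hT⟩ := Finset.exists_superset_card_eq hcard hs
    obtain ⟨t, ht⟩ := Function.ne_iff.1 hξ
    simp only [Pi.zero_apply] at ht
    have htT : t ∈ T := hsub (by simpa using ht)
    refine ⟨T, Finset.mem_powersetCard.2 ⟨Finset.subset_univ _, hT⟩, t, htT, ?_⟩
    have e : (fun a => x a t) = ∑ j ∈ T.erase t, (-(ξ t)⁻¹ * ξ j) • (fun a => x a j) := by
      ext a
      have h1 := h0 a
      rw [dotProduct, ← Finset.sum_subset (Finset.subset_univ T),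
        ← Finset.add_sum_erase T _ htT] at h1
      · simp only [Finset.sum_apply, Pi.smul_apply, smul_eq_mul, mul_assoc]
        rw [← Finset.mul_sum]
        have h2 : ∑ j ∈ T.erase t, ξ j * x a j = - (x a t * ξ t) := by
          rw [eq_neg_iff_add_eq_zero, add_comm, ← h1]
          congr 1
          exact Finset.sum_congr rfl fun j _ => mul_comm _ _
        rw [h2]; field_simp
      · intro j _ hj
        have : ξ j = 0 := by
          by_contra hne
          exact hj (hsub (by simpa using hne))
        simp [this]
    rw [e]
    exact Submodule.sum_mem _ fun j hj => Submodule.smul_mem _ _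
      (Submodule.subset_span ⟨j, hj, rfl⟩)
  calc _ ≤ ∑ x : κ → ι → F, ∑ T ∈ Finset.powersetCard s (Finset.univ : Finset ι), ∑ t ∈ T,
        if (fun a => x a t) ∈ Submodule.span F ((fun j a => x a j) '' (T.erase t)) then
          prodWeight (fun j => prodWeight (fun a => u a j)) (fun j a => x a j) else 0 := by
        rw [Finset.sum_filter]
        refine Finset.sum_le_sum fun x _ => ?_
        have hp : 0 ≤ prodWeight (fun j => prodWeight (fun a => u a j)) (fun j a => x a j) :=
          prodWeight_nonneg (fun j z => prodWeight_nonneg (fun a => hu0 a j) z) _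
        have hterm : ∀ T : Finset ι, ∀ t : ι, 0 ≤
            if (fun a => x a t) ∈ Submodule.span F ((fun j a => x a j) '' (T.erase t)) then
            prodWeight (fun j => prodWeight (fun a => u a j)) (fun j a => x a j) else 0 := by
          intro T t; split_ifs <;> simp [hp]
        split_ifs with h
        · obtain ⟨T, hT, t, ht, hm⟩ := hcover x h
          rw [hprod]
          refine le_trans (le_trans ?_ (Finset.single_le_sum (fun t _ => hterm T t) ht))
            (Finset.single_le_sum
              (f := fun T => ∑ t ∈ T, _) (fun T _ => Finset.sum_nonneg fun t _ => hterm T t) hT)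
          rw [if_pos hm]
        · exact Finset.sum_nonneg fun T _ => Finset.sum_nonneg fun t _ => hterm T t
    _ = ∑ T ∈ Finset.powersetCard s (Finset.univ : Finset ι), ∑ t ∈ T,
        ∑ c ∈ Finset.univ.filter (fun c : ι → κ → F => c t ∈ Submodule.span F (c '' (T.erase t))),
        prodWeight (fun j => prodWeight (fun a => u a j)) c := by
        rw [Finset.sum_comm]
        refine Finset.sum_congr rfl fun T _ => ?_
        rw [Finset.sum_comm]
        refine Finset.sum_congr rfl fun t _ => ?_
        rw [Finset.sum_filter, ← Equiv.sum_comp (Equiv.piComm (fun (_ : κ) (_ : ι) => F))]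
        rfl
    _ ≤ ∑ T ∈ Finset.powersetCard s (Finset.univ : Finset ι), ∑ t ∈ T,
        θ ^ (Fintype.card κ - s) :=
        Finset.sum_le_sum fun T hT => Finset.sum_le_sum fun t ht =>
          hone T t (Finset.mem_powersetCard.1 hT).2 ht
    _ = _ := by
        rw [Finset.sum_congr rfl (g := fun _ => (s : ℝ) * θ ^ (Fintype.card κ - s))]
        · rw [Finset.sum_const, Finset.card_powersetCard, Finset.card_univ, nsmul_eq_mul, mul_assoc]
        · intro T hT
          rw [Finset.sum_const, (Finset.mem_powersetCard.1 hT).2, nsmul_eq_mul]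

/-- Random independent vectors rarely have a sparse normal vector. -/
theorem indepMass_sparse_le {F κ ι : Type*} [Field F] [Fintype F] [Fintype κ] [DecidableEq κ]
    [Fintype ι] [DecidableEq ι] {u : κ → ι → F → ℝ} (hu0 : ∀ a j x, 0 ≤ u a j x)
    (hu1 : ∀ a j, ∑ x, u a j x = 1) {θ : ℝ} (hθ0 : 0 ≤ θ) (hθ1 : θ ≤ 1)
    (hθ : ∀ a j x, u a j x ≤ θ) (s : ℕ) (hs : s ≤ Fintype.card ι)
    (S : Set (Submodule F (ι → F))) (hS : ∀ V ∈ S, ∃ ξ ∈ perp V, ξ ≠ 0 ∧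
      (Finset.univ.filter (fun j => ξ j ≠ 0)).card ≤ s) :
    indepMass (fun a => prodWeight (u a)) S ≤
      (Fintype.card ι).choose s * s * θ ^ (Fintype.card κ - s) := by
  refine le_trans ?_ (sum_prodWeight_sparse_le hu0 hu1 hθ0 hθ1 hθ s hs)
  refine Finset.sum_le_sum_of_subset_of_nonneg ?_ fun x _ _ =>
    prodWeight_nonneg (fun a z => prodWeight_nonneg (hu0 a) z) x
  intro x hx
  obtain ⟨ξ, hξ, hne, hc⟩ := hS _ (Finset.mem_filter.1 hx).2.2
  exact Finset.mem_filter.2 ⟨Finset.mem_univ _, ξ, hne, hc, fun a =>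
    hξ _ (Submodule.subset_span ⟨a, rfl⟩)⟩

section Fourier

variable {F : Type*} [Field F] [Fintype F]

theorem sum_sq_norm_charSum {ψ : AddChar F ℂ} (hψ : ψ.IsPrimitive) {u : F → ℝ}
    (hu : ∑ x, u x = 1) :
    ∑ s, ‖charSum ψ u s‖ ^ 2 = Fintype.card F * ∑ x, u x ^ 2 := by
  have h1 : ∑ s, defect ψ u s = Fintype.card F * (1 - ∑ x, u x ^ 2) := by
    have h2 : ∀ x y : F, ∑ s, u x * u y * (1 - (ψ (s * (x - y))).re) =
        Fintype.card F * (u x * u y - if x = y then u x * u y else 0) := by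
      intro x y
      have h3 := congrArg Complex.re (AddChar.sum_mulShift (x - y) hψ)
      rw [Complex.re_sum] at h3
      rw [← Finset.mul_sum, Finset.sum_sub_distrib, h3]
      by_cases h : x = y
      · subst h; simp
      · simp [h, sub_ne_zero.2 h]; ring
    simp only [defect_eq ψ hu]
    rw [Finset.sum_comm]
    have h4 : ∀ x, ∑ s, ∑ y, u x * u y * (1 - (ψ (s * (x - y))).re) =
        Fintype.card F * (u x - u x ^ 2) := by
      intro x
      rw [Finset.sum_comm]
      simp only [h2]
      rw [← Finset.mul_sum, Finset.sum_sub_distrib, ← Finset.mul_sum, hu]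
      simp [sq]
    simp only [h4]
    rw [← Finset.mul_sum, Finset.sum_sub_distrib, hu]
  simp only [defect, Finset.sum_sub_distrib] at h1
  simp only [Finset.sum_const, Finset.card_univ, nsmul_eq_mul, mul_one] at h1
  linarith

theorem sum_norm_charSum_le {ψ : AddChar F ℂ} (hψ : ψ.IsPrimitive) {u : F → ℝ}
    (hu0 : ∀ x, 0 ≤ u x) (hu : ∑ x, u x = 1) {θ : ℝ} (hθ : ∀ x, u x ≤ θ) :
    ∑ s, ‖charSum ψ u s‖ ≤ Fintype.card F * √θ := by
  have hθ0 : 0 ≤ θ := (hu0 0).trans (hθ 0)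
  refine le_of_sq_le_sq ?_ (by positivity)
  have h2 : (∑ s, ‖charSum ψ u s‖) ^ 2 ≤ Fintype.card F * ∑ s, ‖charSum ψ u s‖ ^ 2 := by
    have := sq_sum_le_card_mul_sum_sq (s := Finset.univ) (f := fun s => ‖charSum ψ u s‖)
    rwa [Finset.card_univ] at this
  rw [sum_sq_norm_charSum hψ hu] at h2
  have h3 : ∑ x, u x ^ 2 ≤ θ := by
    calc ∑ x, u x ^ 2 ≤ ∑ x, u x * θ := Finset.sum_le_sum fun x _ => by
          rw [sq]; exact mul_le_mul_of_nonneg_left (hθ x) (hu0 x)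
      _ = θ := by rw [← Finset.sum_mul, hu, one_mul]
  rw [mul_pow, Real.sq_sqrt hθ0, sq (Fintype.card F : ℝ), mul_assoc]
  exact h2.trans (by gcongr)

/-- The number of vectors orthogonal to a given nonzero vector. -/
theorem card_dotProduct_eq_zero {ι : Type*} [Fintype ι] [DecidableEq ι] {ξ : ι → F}
    (hξ : ξ ≠ 0) :
    (Finset.univ.filter (fun v : ι → F => v ⬝ᵥ ξ = 0)).card * Fintype.card F =
      Fintype.card F ^ Fintype.card ι := by
  have h1 : (Finset.univ.filter (fun v : ι → F => v ⬝ᵥ ξ = 0)).card =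
      Fintype.card (perp (Submodule.span F {ξ})) := by
    rw [Fintype.card_subtype]
    congr 1
    ext v
    simp only [Finset.mem_filter, Finset.mem_univ, true_and, mem_perp]
    constructor
    · intro h x hx
      obtain ⟨c, rfl⟩ := Submodule.mem_span_singleton.1 hx
      rw [smul_dotProduct, dotProduct_comm, h, smul_zero]
    · intro h
      rw [dotProduct_comm]
      exact h ξ (Submodule.mem_span_singleton_self ξ)
  rw [h1, card_perp, finrank_span_singleton hξ, ← pow_succ]
  congr 1
  obtain ⟨j, _⟩ := Function.ne_iff.1 hξ
  have : 0 < Fintype.card ι := Fintype.card_pos_iff.2 ⟨j⟩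
  omega

/-- The average bias of a random subspace. -/
theorem sum_bias_span_le {ι κ : Type*} [Fintype ι] [DecidableEq ι] [Fintype κ] [DecidableEq κ]
    {ψ : AddChar F ℂ} (hψ : ψ.IsPrimitive) {w : ι → F → ℝ}
    (hw0 : ∀ j x, 0 ≤ w j x) (hw1 : ∀ j, ∑ x, w j x = 1) {θ : ℝ} (hθ : ∀ j x, w j x ≤ θ) :
    ∑ x ∈ Finset.univ.filter (fun x : κ → ι → F => LinearIndependent F x),
      bias ψ w (Submodule.span F (Set.range x)) ≤
      (Fintype.card F : ℝ) ^ (Fintype.card ι * Fintype.card κ) * √θ ^ Fintype.card ι := by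
  set q : ℝ := ((Fintype.card F : ℕ) : ℝ) with hq
  have hq0 : 0 < q := by rw [hq]; exact_mod_cast Fintype.card_pos
  set N := Fintype.card ι
  set k := Fintype.card κ
  set f : (ι → F) → ℝ := fun ξ => ∏ j, ‖charSum ψ (w j) (ξ j)‖ with hf
  have hf0 : ∀ ξ, 0 ≤ f ξ := fun ξ => Finset.prod_nonneg fun j _ => norm_nonneg _
  have hfs : ∑ ξ, f ξ ≤ (q * √θ) ^ N := by
    have : ∑ ξ : ι → F, f ξ = ∏ j, ∑ s, ‖charSum ψ (w j) s‖ := by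
      rw [Finset.prod_univ_sum, Fintype.piFinset_univ]
    rw [this]
    refine (Finset.prod_le_prod (fun j _ => Finset.sum_nonneg fun s _ => norm_nonneg _)
      fun j _ => sum_norm_charSum_le hψ (hw0 j) (hw1 j) (hθ j)).trans ?_
    rw [Finset.prod_const, Finset.card_univ]
  have hbias : ∀ x : κ → ι → F, LinearIndependent F x →
      bias ψ w (Submodule.span F (Set.range x)) = (q ^ (N - k))⁻¹ *
        ∑ ξ, if ξ ≠ 0 ∧ ∀ a, x a ⬝ᵥ ξ = 0 then f ξ else 0 := by
    intro x hx
    rw [bias, card_perp, finrank_span_eq_card hx]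
    push_cast
    congr 1
    have hmem : ∀ ξ : ι → F, ξ ∈ perp (Submodule.span F (Set.range x)) ↔
        ∀ a, x a ⬝ᵥ ξ = 0 := by
      intro ξ
      refine ⟨fun h a => h _ (Submodule.subset_span ⟨a, rfl⟩), fun h => mem_perp.2 fun y hy => ?_⟩
      induction hy using Submodule.span_induction with
      | mem y hy => obtain ⟨a, rfl⟩ := hy; exact h a
      | zero => exact zero_dotProduct _
      | add y z _ _ hy hz => rw [add_dotProduct, hy, hz, add_zero]
      | smul c y _ hy => rw [smul_dotProduct, hy, smul_zero]
    have hsub := Finset.sum_subtype (Finset.univ.filter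
      (fun ξ => ξ ∈ perp (Submodule.span F (Set.range x)))) (by simp)
      (fun ξ => if ξ ≠ 0 then f ξ else 0)
      (p := fun ξ => ξ ∈ perp (Submodule.span F (Set.range x))) (F := inferInstance)
    rw [Finset.sum_filter] at hsub
    rw [Finset.sum_filter]
    refine Eq.trans ?_ (hsub.symm.trans ?_)
    · refine Finset.sum_congr rfl fun ξ _ => ?_
      simp only [ne_eq, ← Submodule.coe_eq_zero]
      rfl
    · refine Finset.sum_congr rfl fun ξ _ => ?_
      rw [hmem, ite_and]
      split_ifs <;> rfl
  have hcount : ∀ ξ : ι → F, ξ ≠ 0 →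
      ((Finset.univ.filter (fun x : κ → ι → F => ∀ a, x a ⬝ᵥ ξ = 0)).card : ℝ) =
        q ^ (N * k) / q ^ k := by
    intro ξ hξ
    have h1 : Finset.univ.filter (fun x : κ → ι → F => ∀ a, x a ⬝ᵥ ξ = 0) =
        Fintype.piFinset (fun _ : κ => Finset.univ.filter (fun v : ι → F => v ⬝ᵥ ξ = 0)) := by
      ext x; simp
    rw [h1, Fintype.card_piFinset, Finset.prod_const, Finset.card_univ, eq_div_iff (by positivity),
      pow_mul, hq, ← Nat.cast_pow (Fintype.card F) N, ← card_dotProduct_eq_zero hξ]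
    push_cast
    rw [mul_pow]
  rcases lt_or_ge N k with hNk | hNk
  · rw [Finset.sum_eq_zero]
    · positivity
    · intro x hx
      have := (Finset.mem_filter.1 hx).2.fintype_card_le_finrank
      rw [Module.finrank_fintype_fun_eq_card] at this
      exact absurd this (not_le.2 hNk)
  calc _ = ∑ x ∈ Finset.univ.filter (fun x : κ → ι → F => LinearIndependent F x),
      (q ^ (N - k))⁻¹ * ∑ ξ, if ξ ≠ 0 ∧ ∀ a, x a ⬝ᵥ ξ = 0 then f ξ else 0 :=
        Finset.sum_congr rfl fun x hx => hbias x (Finset.mem_filter.1 hx).2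
    _ ≤ ∑ x : κ → ι → F, (q ^ (N - k))⁻¹ *
        ∑ ξ, if ξ ≠ 0 ∧ ∀ a, x a ⬝ᵥ ξ = 0 then f ξ else 0 := by
        refine Finset.sum_le_univ_sum_of_nonneg fun x => mul_nonneg (by positivity)
          (Finset.sum_nonneg fun ξ _ => ?_)
        split_ifs <;> simp [hf0]
    _ = (q ^ (N - k))⁻¹ * ∑ ξ, ∑ x : κ → ι → F,
          if ξ ≠ 0 ∧ ∀ a, x a ⬝ᵥ ξ = 0 then f ξ else 0 := by
        rw [← Finset.mul_sum, Finset.sum_comm]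
    _ ≤ (q ^ (N - k))⁻¹ * ∑ ξ, q ^ (N * k) / q ^ k * f ξ := by
        refine mul_le_mul_of_nonneg_left (Finset.sum_le_sum fun ξ _ => ?_) (by positivity)
        by_cases hξ : ξ = 0
        · simp only [hξ, ne_eq, not_true_eq_false, false_and, if_false, Finset.sum_const_zero]
          exact mul_nonneg (by positivity) (hf0 _)
        · simp only [ne_eq, hξ, not_false_eq_true, true_and]
          rw [← Finset.sum_filter, Finset.sum_const, nsmul_eq_mul, hcount ξ hξ]
    _ ≤ (q ^ (N - k))⁻¹ * (q ^ (N * k) / q ^ k * (q * √θ) ^ N) := by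
        rw [← Finset.mul_sum]
        gcongr
    _ = _ := by
        have : q ^ N = q ^ (N - k) * q ^ k := by rw [← pow_add]; congr 1; omega
        rw [mul_pow, this]
        field_simp

end Fourier

theorem quarter_le_prod_one_sub {q : ℝ} (hq : 2 ≤ q) (k : ℕ) :
    1 / 4 ≤ ∏ j ∈ Finset.range k, (1 - (q⁻¹) ^ (j + 1)) := by
  have hq' : q⁻¹ ≤ 1 / 2 := by rw [one_div]; exact inv_anti₀ (by norm_num) hq
  have hq0 : 0 ≤ q⁻¹ := by positivity
  rcases Nat.eq_zero_or_pos k with rfl | hk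
  · norm_num
  suffices h : 1 / 4 + (1 / 2 : ℝ) ^ (k + 1) ≤ ∏ j ∈ Finset.range k, (1 - (q⁻¹) ^ (j + 1)) by
    have : (0 : ℝ) ≤ (1 / 2) ^ (k + 1) := by positivity
    linarith
  induction k, hk using Nat.le_induction with
  | base => norm_num; linarith
  | succ k hk ih =>
    rw [Finset.prod_range_succ]
    have h1 : (q⁻¹) ^ (k + 1) ≤ (1 / 2) ^ (k + 1) := pow_le_pow_left₀ hq0 hq' _
    have h2 : (1 / 2 : ℝ) ^ (k + 1) ≤ 1 / 4 := by
      calc (1 / 2 : ℝ) ^ (k + 1) ≤ (1 / 2) ^ 2 :=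
            pow_le_pow_of_le_one (by norm_num) (by norm_num) (by omega)
        _ = 1 / 4 := by norm_num
    have h3 : (0 : ℝ) < (1 / 2) ^ (k + 1) := by positivity
    have e : (1 / 2 : ℝ) ^ (k + 1 + 1) = (1 / 2) ^ (k + 1) / 2 := by rw [pow_succ]; ring
    rw [e]
    set p : ℝ := (1 / 2) ^ (k + 1)
    calc 1 / 4 + p / 2 ≤ (1 / 4 + p) * (1 - p) := by nlinarith
      _ ≤ _ := by
        apply mul_le_mul ih (by linarith) (by linarith)
        exact le_trans (by positivity) ih

theorem card_pow_le_four_mul_card_linearIndependent {F E : Type*} [Field F] [Fintype F]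
    [AddCommGroup E] [Module F E] [Fintype E] {k : ℕ} (V : Submodule F E)
    (hV : Module.finrank F V = k) :
    (Fintype.card F : ℝ) ^ (k * k) ≤ 4 * (Finset.univ.filter (fun x : Fin k → E =>
      LinearIndependent F x ∧ Submodule.span F (Set.range x) = V)).card := by
  have hq2 : 2 ≤ Fintype.card F := Fintype.one_lt_card
  have h1 : (Nat.card {x : Fin k → V // LinearIndependent F x} : ℝ) =
      (Fintype.card F : ℝ) ^ (k * k) *
        ∏ j ∈ Finset.range k, (1 - ((Fintype.card F : ℝ)⁻¹) ^ (j + 1)) := by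
    rw [card_linearIndependent (by omega), hV]
    push_cast
    have e : (Fintype.card F : ℝ) ^ (k * k) = ∏ _i : Fin k, (Fintype.card F : ℝ) ^ k := by
      simp [pow_mul]
    rw [← Finset.prod_range_reflect, ← Fin.prod_univ_eq_prod_range (fun i => 1 -
      ((Fintype.card F : ℝ)⁻¹) ^ (k - 1 - i + 1)), e, ← Finset.prod_mul_distrib]
    refine Finset.prod_congr rfl fun i _ => ?_
    have hi := i.2
    rw [Nat.cast_sub (Nat.pow_le_pow_right (by omega) (by omega))]
    have : k - 1 - (i : ℕ) + 1 = k - i := by omega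
    have hc : (Fintype.card F : ℝ) ≠ 0 := by positivity
    rw [this, mul_one_sub, inv_pow]
    push_cast
    congr 1
    rw [eq_mul_inv_iff_mul_eq₀ (by positivity), ← pow_add]
    congr 1; omega
  have h2 : Nat.card {x : Fin k → V // LinearIndependent F x} ≤
      (Finset.univ.filter (fun x : Fin k → E =>
      LinearIndependent F x ∧ Submodule.span F (Set.range x) = V)).card := by
    rw [← Fintype.card_subtype, ← Nat.card_eq_fintype_card]
    refine Nat.card_le_card_of_injective
      (fun x => ⟨fun a => (x.1 a : E), x.2.map' V.subtype V.ker_subtype, ?_⟩) ?_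
    · have hx := x.2.map' V.subtype V.ker_subtype
      refine Submodule.eq_of_le_of_finrank_eq (Submodule.span_le.2 ?_) ?_
      · rintro _ ⟨a, rfl⟩; exact (x.1 a).2
      · rw [hV]
        exact (finrank_span_eq_card hx).trans (Fintype.card_fin k)
    · intro x y h
      ext a
      exact congrFun (congrArg Subtype.val h) a
  have h3 := quarter_le_prod_one_sub (q := Fintype.card F) (by exact_mod_cast hq2) k
  have h4 : ((Nat.card {x : Fin k → V // LinearIndependent F x} : ℕ) : ℝ) ≤
    ((Finset.univ.filter (fun x : Fin k → E =>
      LinearIndependent F x ∧ Submodule.span F (Set.range x) = V)).card : ℝ) := by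
    exact_mod_cast h2
  rw [h1] at h4
  have h5 : (0 : ℝ) ≤ (Fintype.card F : ℝ) ^ (k * k) := by positivity
  nlinarith

/-- The weight of the families spanning a subspace is at most the weight of the families
contained in it. -/
theorem indepMass_le_sum_prod {F κ E : Type*} [Field F] [AddCommGroup E] [Module F E]
    [Fintype κ] [DecidableEq κ] [Fintype E] {u : κ → E → ℝ} (hu : ∀ a z, 0 ≤ u a z)
    (S : Set (Submodule F E)) :
    indepMass u S ≤ ∑ V : Submodule F E with V ∈ S ∧ Module.finrank F V = Fintype.card κ,
      ∏ a, submoduleMass (u a) V := by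
  have h1 : ∀ V : Submodule F E, ∏ a, submoduleMass (u a) V =
      ∑ x : κ → E, if ∀ a, x a ∈ V then prodWeight u x else 0 := by
    intro V
    simp only [submoduleMass, Finset.sum_filter]
    rw [Finset.prod_univ_sum, Fintype.piFinset_univ]
    refine Finset.sum_congr rfl fun x _ => ?_
    split_ifs with h
    · exact Finset.prod_congr rfl fun a _ => if_pos (h a)
    · push Not at h
      obtain ⟨a, ha⟩ := h
      exact Finset.prod_eq_zero (Finset.mem_univ a) (if_neg ha)
  simp only [h1]
  rw [Finset.sum_comm, indepMass, Finset.sum_filter]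
  refine Finset.sum_le_sum fun x _ => ?_
  have h0 := prodWeight_nonneg hu x
  have h2 : ∀ V : Submodule F E, 0 ≤ if ∀ a, x a ∈ V then prodWeight u x else 0 := by
    intro V; split_ifs <;> simp [h0]
  split_ifs with h
  · refine le_trans ?_ (Finset.single_le_sum
      (f := fun V : Submodule F E => if ∀ a, x a ∈ V then prodWeight u x else 0)
      (fun V _ => h2 V) (a := Submodule.span F (Set.range x)) ?_)
    · have h3 : ∀ a, x a ∈ Submodule.span F (Set.range x) := fun a =>
        Submodule.subset_span (Set.mem_range_self a)
      rw [if_pos h3]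
    · exact Finset.mem_filter.2 ⟨Finset.mem_univ _, h.2, finrank_span_eq_card h.1⟩
  · exact Finset.sum_nonneg fun V _ => h2 V

/-- Random families whose span has an atypically large bias, but not a very large one, are rare. -/
theorem indepMass_le_of_le_bias {F ι I : Type*} [Field F] [Fintype F] [Fintype ι] [DecidableEq ι]
    [Fintype I] {ψ : AddChar F ℂ} (hψ : ψ.IsPrimitive) {k : ℕ} (hk : k ≤ Fintype.card ι)
    {u : Fin k → (ι → F) → ℝ} (hu : ∀ a z, 0 ≤ u a z) {w : I → ι → F → ℝ}
    (hw0 : ∀ i j x, 0 ≤ w i j x) (hw1 : ∀ i j, ∑ x, w i j x = 1) {θ : ℝ}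
    (hθ : ∀ i j x, w i j x ≤ θ) {A δ : ℝ} (hA0 : 0 ≤ A) (hδ : 0 < δ)
    (S : Set (Submodule F (ι → F)))
    (hA : ∀ V ∈ S, Module.finrank F V = k → ∀ a, submoduleMass (u a) V ≤
      A * ((Fintype.card F : ℝ) ^ (Fintype.card ι - k))⁻¹)
    (hS : ∀ V ∈ S, Module.finrank F V = k → ∃ i, δ ≤ bias ψ (w i) V) :
    indepMass u S ≤ Fintype.card I * (4 / δ) * A ^ k * √θ ^ Fintype.card ι := by
  set q : ℝ := ((Fintype.card F : ℕ) : ℝ) with hq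
  have hq0 : 0 < q := by rw [hq]; exact_mod_cast Fintype.card_pos
  set N := Fintype.card ι
  have hpow : (q ^ (N - k))⁻¹ ^ k = q ^ (k * k) / q ^ (N * k) := by
    have : q ^ (N * k) = (q ^ (N - k)) ^ k * q ^ (k * k) := by
      rw [← pow_mul, ← pow_add]; congr 1; rw [← add_mul, Nat.sub_add_cancel hk]
    rw [this, inv_pow]; field_simp
  have hcount : ∀ V : Submodule F (ι → F), ((Finset.univ.filter (fun x : Fin k → ι → F =>
      LinearIndependent F x ∧ Submodule.span F (Set.range x) = V)).card : ℝ) =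
      ∑ x ∈ Finset.univ.filter (fun x : Fin k → ι → F => LinearIndependent F x),
        if Submodule.span F (Set.range x) = V then 1 else 0 := by
    intro V
    rw [← Finset.filter_filter, Finset.card_filter]
    push_cast
    rfl
  calc indepMass u S ≤ ∑ V : Submodule F (ι → F) with V ∈ S ∧ Module.finrank F V = k,
      ∏ a, submoduleMass (u a) V := by
        have := indepMass_le_sum_prod hu S
        simpa only [Fintype.card_fin] using this
    _ ≤ ∑ V : Submodule F (ι → F) with V ∈ S ∧ Module.finrank F V = k,
        A ^ k * (4 / q ^ (N * k)) * (Finset.univ.filter (fun x : Fin k → ι → F =>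
      LinearIndependent F x ∧ Submodule.span F (Set.range x) = V)).card := by
        refine Finset.sum_le_sum fun V hV => ?_
        obtain ⟨hVS, hVk⟩ := (Finset.mem_filter.1 hV).2
        have h1 : ∏ a, submoduleMass (u a) V ≤ (A * (q ^ (N - k))⁻¹) ^ k := by
          refine (Finset.prod_le_prod (fun a _ => submoduleMass_nonneg (hu a) V)
            fun a _ => hA V hVS hVk a).trans ?_
          simp
        refine h1.trans ?_
        rw [mul_pow, hpow, mul_assoc]
        refine mul_le_mul_of_nonneg_left ?_ (by positivity)
        rw [div_mul_eq_mul_div]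
        gcongr
        exact card_pow_le_four_mul_card_linearIndependent V hVk
    _ = A ^ k * (4 / q ^ (N * k)) * ∑ x ∈ Finset.univ.filter (fun x : Fin k → ι → F =>
          LinearIndependent F x), ∑ V : Submodule F (ι → F) with V ∈ S ∧ Module.finrank F V = k,
            if Submodule.span F (Set.range x) = V then 1 else 0 := by
        simp only [hcount]
        rw [← Finset.mul_sum, Finset.sum_comm]
    _ ≤ A ^ k * (4 / q ^ (N * k)) * ∑ x ∈ Finset.univ.filter (fun x : Fin k → ι → F =>
          LinearIndependent F x), ∑ i, δ⁻¹ * bias ψ (w i) (Submodule.span F (Set.range x)) := by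
        refine mul_le_mul_of_nonneg_left (Finset.sum_le_sum fun x hx => ?_) (by positivity)
        have hnn : ∀ i, 0 ≤ δ⁻¹ * bias ψ (w i) (Submodule.span F (Set.range x)) := fun i =>
          mul_nonneg (by positivity) (bias_nonneg _ _ _)
        rw [Finset.sum_ite_eq]
        split_ifs with h
        · obtain ⟨i, hi⟩ := hS _ (Finset.mem_filter.1 h).2.1 (Finset.mem_filter.1 h).2.2
          refine le_trans ?_ (Finset.single_le_sum (fun i _ => hnn i) (Finset.mem_univ i))
          rw [inv_mul_eq_div, one_le_div hδ]
          exact hi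
        · exact Finset.sum_nonneg fun i _ => hnn i
    _ ≤ A ^ k * (4 / q ^ (N * k)) * ∑ _i : I, δ⁻¹ * (q ^ (N * k) * √θ ^ N) := by
        rw [Finset.sum_comm]
        refine mul_le_mul_of_nonneg_left (Finset.sum_le_sum fun i _ => ?_) (by positivity)
        rw [← Finset.mul_sum]
        refine mul_le_mul_of_nonneg_left ?_ (by positivity)
        have := sum_bias_span_le (κ := Fin k) hψ (hw0 i) (hw1 i) (hθ i)
        rwa [Fintype.card_fin] at this
    _ = _ := by
        rw [Finset.sum_const, Finset.card_univ, nsmul_eq_mul]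
        field_simp

/-- Steinitz exchange: a linearly independent family in the span of `x` can be completed to a
spanning set by some of the vectors of `x`. -/
theorem exists_finset_span_union_eq {F E : Type*} [Field F] [AddCommGroup E] [Module F E]
    [Fintype E] {k r : ℕ} {x : Fin k → E} {y : Fin r → E} (hx : LinearIndependent F x)
    (hy : LinearIndependent F y) (hyx : ∀ b, y b ∈ Submodule.span F (Set.range x)) :
    ∃ T : Finset (Fin k), T.card + r = k ∧
      Submodule.span F (Set.range y ∪ Set.range fun a : {a // a ∈ T} => x a) =
        Submodule.span F (Set.range x) := by
  obtain ⟨b, hbt, hsb, htb, hli⟩ := exists_linearIndepOn_id_extension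
    (hy.linearIndepOn_id : LinearIndepOn F id (Set.range y))
    (Set.subset_union_left : Set.range y ⊆ Set.range y ∪ Set.range x)
  have hspan : Submodule.span F b = Submodule.span F (Set.range x) := by
    apply le_antisymm
    · refine Submodule.span_le.2 (hbt.trans (Set.union_subset ?_ Submodule.subset_span))
      rintro _ ⟨a, rfl⟩; exact hyx a
    · exact Submodule.span_le.2 (Set.subset_union_right.trans htb)
  set T : Finset (Fin k) := Finset.univ.filter (fun a => x a ∈ b ∧ x a ∉ Set.range y) with hT
  have hb : b = Set.range y ∪ Set.range fun a : {a // a ∈ T} => x a := by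
    ext v
    constructor
    · intro hv
      by_cases hvy : v ∈ Set.range y
      · exact Or.inl hvy
      · rcases hbt hv with h | ⟨a, rfl⟩
        · exact Or.inl h
        · exact Or.inr ⟨⟨a, by simp only [hT, Finset.mem_filter, Finset.mem_univ, true_and]; exact ⟨hv, hvy⟩⟩, rfl⟩
    · rintro (h | ⟨a, rfl⟩)
      · exact hsb h
      · exact (Finset.mem_filter.1 a.2).2.1
  refine ⟨T, ?_, by rw [← hb, hspan]⟩
  have h1 := finrank_span_set_eq_card hli
  rw [hspan, finrank_span_eq_card hx, Fintype.card_fin] at h1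
  have h2 : b.toFinset = Finset.univ.image y ∪ T.image x := by
    ext v
    rw [Set.mem_toFinset, hb]
    simp
  rw [h2, Finset.card_union_of_disjoint, Finset.card_image_of_injective _ hy.injective,
    Finset.card_image_of_injective _ hx.injective, Finset.card_univ, Fintype.card_fin] at h1
  · omega
  · rw [Finset.disjoint_left]
    intro v hv hv'
    obtain ⟨a, ha, rfl⟩ := Finset.mem_image.1 hv'
    obtain ⟨c, _, hc⟩ := Finset.mem_image.1 hv
    exact (Finset.mem_filter.1 ha).2.2 ⟨c, hc⟩

theorem half_pow_le_sum_linearIndependent {F E : Type*} [Field F] [AddCommGroup E] [Module F E]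
    [Fintype E] {Q : E → ℝ} (hQ : ∀ z, 0 ≤ Q z) (r : ℕ) {B : ℝ}
    (hB : ∀ U : Submodule F E, Module.finrank F U + 1 ≤ r → submoduleMass Q U ≤ B)
    (V : Submodule F E) (hBV : r * B ≤ submoduleMass Q V / 2) :
    submoduleMass Q V ^ r / 2 ≤ ∑ y : Fin r → E, if LinearIndependent F y ∧ ∀ b, y b ∈ V then
      prodWeight (fun _ => Q) y else 0 := by
  set M := submoduleMass Q V with hM
  have hM0 : 0 ≤ M := submoduleMass_nonneg hQ V
  set QV : E → ℝ := fun z => if z ∈ V then Q z else 0 with hQV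
  have hQV0 : ∀ z, 0 ≤ QV z := fun z => by simp only [hQV]; split_ifs <;> simp [hQ]
  have hQVs : ∑ z, QV z = M := by rw [hM, submoduleMass, Finset.sum_filter]
  have h1 : ∀ y : Fin r → E, prodWeight (fun _ => QV) y =
      if ∀ b, y b ∈ V then prodWeight (fun _ => Q) y else 0 := by
    intro y
    split_ifs with h
    · exact Finset.prod_congr rfl fun b _ => if_pos (h b)
    · push Not at h
      obtain ⟨b, hb⟩ := h
      exact Finset.prod_eq_zero (Finset.mem_univ b) (if_neg hb)
  have h2 := sum_prodWeight_not_linearIndependent_le (F := F) (κ := Fin r) (u := fun _ => QV)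
    (fun _ z => hQV0 z) B (by
      intro j U hU
      rw [Fintype.card_fin] at hU
      refine le_trans (Finset.sum_le_sum fun z _ => ?_) (hB U hU)
      simp only [hQV]; split_ifs <;> simp [hQ])
  have h3 := sum_prodWeight (κ := Fin r) (fun _ => QV)
  simp only [hQVs, Finset.prod_const, Finset.card_univ, Fintype.card_fin] at h2 h3
  have h4 : ∀ j : Fin r, Fintype.card {a // a ≠ j} = r - 1 := by
    intro j; simp [Fintype.card_subtype_compl]
  simp only [h4, Finset.sum_const, Finset.card_univ, Fintype.card_fin, nsmul_eq_mul] at h2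
  have h5 : (r : ℝ) * (M ^ (r - 1) * B) ≤ M ^ r / 2 := by
    rcases Nat.eq_zero_or_pos r with rfl | hr
    · simp
    · have : M ^ r = M ^ (r - 1) * M := by rw [← pow_succ]; congr 1; omega
      rw [this]
      have := mul_le_mul_of_nonneg_left hBV (pow_nonneg hM0 (r - 1))
      linarith
  have h6 := Finset.sum_filter_add_sum_filter_not Finset.univ
    (fun y : Fin r → E => LinearIndependent F y) (prodWeight (fun _ => QV))
  have h7 : ∑ y ∈ Finset.univ.filter (fun y : Fin r → E => LinearIndependent F y),
      prodWeight (fun _ => QV) y = ∑ y : Fin r → E, if LinearIndependent F y ∧ ∀ b, y b ∈ V then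
      prodWeight (fun _ => Q) y else 0 := by
    rw [Finset.sum_filter]
    refine Finset.sum_congr rfl fun y _ => ?_
    rw [h1, ite_and]
  rw [← h7]
  linarith

/-- The swapping argument: if `Q` gives much more mass to each subspace in `S` than the measures
`P j`, then random vectors distributed according to `P` are unlikely to span a member of `S`. -/
theorem indepMass_le_of_swap {F E : Type*} [Field F] [AddCommGroup E] [Module F E]
    [Fintype E] {k : ℕ} {P : Fin k → E → ℝ} (hP : ∀ a z, 0 ≤ P a z) (hP1 : ∀ a, ∑ z, P a z = 1)
    {Q : E → ℝ} (hQ : ∀ z, 0 ≤ Q z) (hQ1 : ∑ z, Q z = 1) (r : ℕ) {B δ η : ℝ}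
    (hδ : 0 < δ) (hη : 0 ≤ η)
    (hB : ∀ U : Submodule F E, Module.finrank F U + 1 ≤ r → submoduleMass Q U ≤ B)
    (hBδ : r * B ≤ δ / 2) (S : Set (Submodule F E))
    (hSQ : ∀ V ∈ S, Module.finrank F V = k → δ ≤ submoduleMass Q V)
    (hSP : ∀ V ∈ S, Module.finrank F V = k → ∀ a, submoduleMass (P a) V ≤ η * submoduleMass Q V) :
    indepMass P S ≤ 2 * 2 ^ k * η ^ r := by
  set A : Finset (Fin k) → Submodule F E → ℝ := fun T V => ∑ y : Fin r → E, ∑ x : Fin k → E,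
    prodWeight (fun _ => Q) y * (prodWeight P x *
      if Submodule.span F (Set.range y ∪ Set.range fun a : {a // a ∈ T} => x a) = V then 1 else 0)
    with hA
  have hw : ∀ (y : Fin r → E) (x : Fin k → E),
      0 ≤ prodWeight (fun _ => Q) y * prodWeight P x := fun y x =>
    mul_nonneg (prodWeight_nonneg (fun _ => hQ) y) (prodWeight_nonneg hP x)
  have hZ : ∀ V ∈ S, Module.finrank F V = k →
      (∑ x : Fin k → E, if LinearIndependent F x ∧ Submodule.span F (Set.range x) = V then
        prodWeight P x else 0) ≤
      2 * η ^ r * ∑ T : Finset (Fin k) with T.card + r = k, A T V := by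
    intro V hVS hVk
    set M := submoduleMass Q V with hM
    have hM0 : 0 < M := hδ.trans_le (hSQ V hVS hVk)
    have hY := half_pow_le_sum_linearIndependent hQ r hB V
      (hBδ.trans (by have := hSQ V hVS hVk; linarith))
    set Y := ∑ y : Fin r → E, if LinearIndependent F y ∧ ∀ b, y b ∈ V then
      prodWeight (fun _ => Q) y else 0 with hYd
    set Z := ∑ x : Fin k → E, if LinearIndependent F x ∧ Submodule.span F (Set.range x) = V then
        prodWeight P x else 0 with hZd
    have hZ0 : 0 ≤ Z := Finset.sum_nonneg fun x _ => by
      split_ifs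
      · exact prodWeight_nonneg hP x
      · exact le_rfl
    have h1 : Y * Z ≤ ∑ T : Finset (Fin k) with T.card + r = k, ∑ y : Fin r → E,
        ∑ x : Fin k → E, prodWeight (fun _ => Q) y * (prodWeight P x *
          ((if ∀ a, ¬ a ∈ T → x a ∈ V then 1 else 0) *
          if Submodule.span F (Set.range y ∪ Set.range fun a : {a // a ∈ T} => x a) = V
            then 1 else 0)) := by
      rw [hYd, hZd, Finset.sum_mul_sum, Finset.sum_comm (s := Finset.filter _ _)]
      refine Finset.sum_le_sum fun y _ => ?_
      rw [Finset.sum_comm (s := Finset.filter _ _)]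
      refine Finset.sum_le_sum fun x _ => ?_
      have hnn : ∀ T : Finset (Fin k), 0 ≤ prodWeight (fun _ => Q) y * (prodWeight P x *
          ((if ∀ a, ¬ a ∈ T → x a ∈ V then 1 else 0) *
          if Submodule.span F (Set.range y ∪ Set.range fun a : {a // a ∈ T} => x a) = V
            then 1 else 0)) := by
        intro T
        rw [← mul_assoc]
        refine mul_nonneg (hw y x) ?_
        split_ifs <;> simp
      by_cases hy : LinearIndependent F y ∧ ∀ b, y b ∈ V
      · by_cases hx : LinearIndependent F x ∧ Submodule.span F (Set.range x) = V
        · obtain ⟨T, hT, hs⟩ := exists_finset_span_union_eq hx.1 hy.1 (by rw [hx.2]; exact hy.2)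
          rw [hx.2] at hs
          have hxV : ∀ a, ¬ a ∈ T → x a ∈ V := fun a _ => by
            rw [← hx.2]; exact Submodule.subset_span (Set.mem_range_self a)
          refine le_trans ?_ (Finset.single_le_sum (f := fun T : Finset (Fin k) => _)
            (fun T _ => hnn T)
            (Finset.mem_filter.2 ⟨Finset.mem_univ T, hT⟩))
          rw [if_pos hy, if_pos hx, if_pos hxV, if_pos hs]
          simp
        · rw [if_neg hx, mul_zero]
          exact Finset.sum_nonneg fun T _ => hnn T
      · rw [if_neg hy, zero_mul]
        exact Finset.sum_nonneg fun T _ => hnn T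
    have h2 : ∀ T : Finset (Fin k), T.card + r = k → (∑ y : Fin r → E,
        ∑ x : Fin k → E, prodWeight (fun _ => Q) y * (prodWeight P x *
          ((if ∀ a, ¬ a ∈ T → x a ∈ V then 1 else 0) *
          if Submodule.span F (Set.range y ∪ Set.range fun a : {a // a ∈ T} => x a) = V
            then 1 else 0))) ≤ (η * M) ^ r * A T V := by
      intro T hT
      rw [hA, Finset.mul_sum]
      refine Finset.sum_le_sum fun y _ => ?_
      have e : ∑ x : Fin k → E, prodWeight P x * ((if ∀ a, ¬ a ∈ T → x a ∈ V then 1 else 0) *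
          if Submodule.span F (Set.range y ∪ Set.range fun a : {a // a ∈ T} => x a) = V
            then 1 else 0) = (∏ a : {a // ¬ a ∈ T}, submoduleMass (P a) V) *
          ∑ x : Fin k → E, prodWeight P x *
          if Submodule.span F (Set.range y ∪ Set.range fun a : {a // a ∈ T} => x a) = V
            then 1 else 0 := by
        convert sum_prodWeight_mul_of_mem_submodule (fun a => a ∈ T) hP1 V
          (fun z => if Submodule.span F (Set.range y ∪ Set.range z) = V then 1 else 0)
      rw [← Finset.mul_sum, e, ← Finset.mul_sum, mul_left_comm]
      refine mul_le_mul_of_nonneg_right ?_ (mul_nonneg (prodWeight_nonneg (fun _ => hQ) y)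
        (Finset.sum_nonneg fun x _ => mul_nonneg (prodWeight_nonneg hP x) (by split_ifs <;> simp)))
      refine (Finset.prod_le_prod
        (fun (a : {a // ¬ a ∈ T}) _ => submoduleMass_nonneg (hP a) V)
        fun a _ => hSP V hVS hVk a).trans ?_
      rw [Finset.prod_const, Finset.card_univ, Fintype.card_subtype_compl]
      simp only [Fintype.card_fin, Fintype.card_coe]
      rw [show k - T.card = r by omega]
    have h3 : M ^ r / 2 * Z ≤ (η * M) ^ r * ∑ T : Finset (Fin k) with T.card + r = k, A T V := by
      refine (mul_le_mul_of_nonneg_right hY hZ0).trans (h1.trans ?_)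
      rw [Finset.mul_sum]
      exact Finset.sum_le_sum fun T hT => h2 T (Finset.mem_filter.1 hT).2
    have h4 : 0 < M ^ r := pow_pos hM0 r
    rw [mul_pow] at h3
    have h5 : M ^ r * Z ≤ M ^ r *
        (2 * η ^ r * ∑ T : Finset (Fin k) with T.card + r = k, A T V) := by linarith
    exact le_of_mul_le_mul_left h5 h4
  have hAsum : ∀ T : Finset (Fin k), ∑ V : Submodule F E, A T V = 1 := by
    intro T
    rw [hA, Finset.sum_comm]
    have : ∀ y : Fin r → E, ∑ V : Submodule F E, ∑ x : Fin k → E,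
        prodWeight (fun _ => Q) y * (prodWeight P x *
      if Submodule.span F (Set.range y ∪ Set.range fun a : {a // a ∈ T} => x a) = V then 1 else 0)
        = prodWeight (fun _ => Q) y := by
      intro y
      rw [Finset.sum_comm]
      simp only [← Finset.mul_sum, Finset.sum_ite_eq, Finset.mem_univ, if_true, mul_one]
      rw [sum_prodWeight]
      simp [hP1]
    rw [Finset.sum_congr rfl fun y _ => this y, sum_prodWeight]
    simp [hQ1]
  have hA0 : ∀ T V, 0 ≤ A T V := fun T V =>
    Finset.sum_nonneg fun y _ => Finset.sum_nonneg fun x _ => by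
      rw [← mul_assoc]
      exact mul_nonneg (hw y x) (by split_ifs <;> simp)
  calc indepMass P S ≤ ∑ V : Submodule F E with V ∈ S ∧ Module.finrank F V = k,
        ∑ x : Fin k → E, if LinearIndependent F x ∧ Submodule.span F (Set.range x) = V then
        prodWeight P x else 0 := by
        rw [Finset.sum_comm, indepMass, Finset.sum_filter]
        refine Finset.sum_le_sum fun x _ => ?_
        have h0 := prodWeight_nonneg hP x
        have h2 : ∀ V : Submodule F E, 0 ≤ if LinearIndependent F x ∧
            Submodule.span F (Set.range x) = V then prodWeight P x else 0 := by
          intro V; split_ifs <;> simp [h0]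
        by_cases h : LinearIndependent F x ∧ Submodule.span F (Set.range x) ∈ S
        · rw [if_pos h]
          refine le_trans ?_ (Finset.single_le_sum (f := fun V : Submodule F E => _)
            (fun V _ => h2 V) (Finset.mem_filter.2 ⟨Finset.mem_univ _, h.2,
              (finrank_span_eq_card h.1).trans (Fintype.card_fin k)⟩))
          rw [if_pos ⟨h.1, rfl⟩]
        · rw [if_neg h]
          exact Finset.sum_nonneg fun V _ => h2 V
    _ ≤ ∑ V : Submodule F E with V ∈ S ∧ Module.finrank F V = k,
        2 * η ^ r * ∑ T : Finset (Fin k) with T.card + r = k, A T V :=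
        Finset.sum_le_sum fun V hV => hZ V (Finset.mem_filter.1 hV).2.1 (Finset.mem_filter.1 hV).2.2
    _ ≤ ∑ V : Submodule F E, 2 * η ^ r * ∑ T : Finset (Fin k), A T V := by
        refine (Finset.sum_le_sum fun V _ => mul_le_mul_of_nonneg_left
          (Finset.sum_le_univ_sum_of_nonneg fun T => hA0 T V) (by positivity)).trans ?_
        exact Finset.sum_le_univ_sum_of_nonneg fun V => mul_nonneg (by positivity)
          (Finset.sum_nonneg fun T _ => hA0 T V)
    _ = 2 * 2 ^ k * η ^ r := by
        rw [← Finset.mul_sum, Finset.sum_comm]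
        simp only [hAsum, Finset.sum_const, Finset.card_univ, Fintype.card_finset, Fintype.card_fin]
        simp
        ring

theorem indepMass_le_sum_of_cover {F κ E I : Type*} [Field F] [AddCommGroup E] [Module F E]
    [Fintype κ] [DecidableEq κ] [Fintype E] [Fintype I] {u : κ → E → ℝ} (hu : ∀ a z, 0 ≤ u a z)
    {S : Set (Submodule F E)} (T : I → Set (Submodule F E)) (h : ∀ V ∈ S, ∃ i, V ∈ T i) :
    indepMass u S ≤ ∑ i, indepMass u (T i) := by
  simp only [indepMass, Finset.sum_filter]
  rw [Finset.sum_comm]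
  refine Finset.sum_le_sum fun x _ => ?_
  have h0 := prodWeight_nonneg hu x
  have h1 : ∀ i, 0 ≤ if LinearIndependent F x ∧ Submodule.span F (Set.range x) ∈ T i then
      prodWeight u x else 0 := by
    intro i; split_ifs <;> simp [h0]
  by_cases hx : LinearIndependent F x ∧ Submodule.span F (Set.range x) ∈ S
  · obtain ⟨i, hi⟩ := h _ hx.2
    refine le_trans ?_ (Finset.single_le_sum (f := fun i => _) (fun i _ => h1 i) (Finset.mem_univ i))
    rw [if_pos hx, if_pos ⟨hx.1, hi⟩]
  · rw [if_neg hx]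
    exact Finset.sum_nonneg fun i _ => h1 i

section LazySymm

variable {F : Type*} [Field F] [Fintype F] {α β : ℝ} {u : F → ℝ}

theorem lazySymm_nonneg (hβ0 : 0 ≤ β) (hβ1 : β ≤ 1) (hu : ∀ x, 0 ≤ u x) (x : F) :
    0 ≤ lazySymm β u x := by
  refine add_nonneg (mul_nonneg (by linarith) (by split_ifs <;> simp))
    (mul_nonneg hβ0 (Finset.sum_nonneg fun y _ => mul_nonneg (hu _) (hu _)))

theorem sum_lazySymm (hu : ∑ x, u x = 1) : ∑ x, lazySymm β u x = 1 := by
  simp only [lazySymm, Finset.sum_add_distrib, ← Finset.mul_sum]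
  rw [Finset.sum_comm]
  have : ∀ y, ∑ x, u (x + y) * u y = u y := by
    intro y
    have h := Equiv.sum_comp (Equiv.addRight y) u
    simp only [Equiv.coe_addRight] at h
    rw [← Finset.sum_mul, h, hu, one_mul]
  simp only [this, hu]
  simp

theorem lazySymm_le (hβ0 : 0 ≤ β) (hβ1 : β ≤ 1) (hu : IsBalanced α u) (x : F) :
    lazySymm β u x ≤ 1 - α * β := by
  have h1 : ∑ y, u (x + y) * u y ≤ 1 - α := by
    calc ∑ y, u (x + y) * u y ≤ ∑ y, (1 - α) * u y := Finset.sum_le_sum fun y _ =>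
          mul_le_mul_of_nonneg_right (hu.apply_le _) (hu.1 y)
      _ = 1 - α := by rw [← Finset.mul_sum, hu.2.1, mul_one]
  have h2 : (1 - β) * (if x = 0 then 1 else 0) ≤ 1 - β := by
    split_ifs <;> linarith
  have h3 := mul_le_mul_of_nonneg_left h1 hβ0
  rw [lazySymm]
  linarith

end LazySymm

/-- It is unlikely that the span of independent random vectors with balanced coordinates has a
large bias. -/
theorem indepMass_lt_bias_le {F : Type*} [Field F] [Fintype F] {ψ : AddChar F ℂ}
    (hψ : ψ.IsPrimitive) {α : ℝ} (hα0 : 0 < α) (hα1 : α < 1) {n k : ℕ} (hk : k < n)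
    {w : ℕ → Fin n → F → ℝ} (hw : ∀ i j, IsBalanced α (w i j)) (s m r : ℕ) (hs : s ≤ n)
    {τ δ : ℝ} (hτ : 0 < τ) (hδ : 0 < δ) (hsδ : Real.exp (-(α * s / (2 * 4 ^ m))) ≤ δ / 2)
    (hrδ : r * (1 - α * (4 ^ (m + 1))⁻¹) ^ (n - r) ≤ δ / 4) :
    indepMass (fun i : Fin k => prodWeight (w i)) {V : Submodule F (Fin n → F) |
      δ < bias ψ (w k) V} ≤
      n.choose s * s * (1 - α) ^ (k - s) + n * (4 / δ) * (1 + τ) ^ k * √(1 - α) ^ n +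
        n * (2 * 2 ^ k * ((τ⁻¹ + 1) * (2 * (2 / 3) ^ m)) ^ r) := by
  have hw0 : ∀ i j x, 0 ≤ w i j x := fun i j => (hw i j).1
  have hw1 : ∀ i j, ∑ x, w i j x = 1 := fun i j => (hw i j).2.1
  have hP0 : ∀ i z, 0 ≤ prodWeight (w i) z := fun i z => prodWeight_nonneg (hw0 i) z
  have hP1 : ∀ i, ∑ z, prodWeight (w i) z = 1 := fun i => by rw [sum_prodWeight]; simp [hw1]
  set q : ℝ := ((Fintype.card F : ℕ) : ℝ) with hq
  have hq0 : 0 < q := by rw [hq]; exact_mod_cast Fintype.card_pos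
  have hmass : ∀ V : Submodule F (Fin n → F), Module.finrank F V = k → ∀ i,
      submoduleMass (prodWeight (w i)) V ≤ (q ^ (n - k))⁻¹ + bias ψ (w i) V := by
    intro V hV i
    have := (abs_le.1 (abs_submoduleMass_sub_le hψ V (hw1 i))).2
    rw [card_perp, hV, Fintype.card_fin] at this
    push_cast at this
    linarith
  set β : ℝ := (4 ^ (m + 1))⁻¹ with hβ
  have hβ0 : 0 ≤ β := by positivity
  have hβ1 : β ≤ 1 := inv_le_one_of_one_le₀ (one_le_pow₀ (by norm_num))
  set A₀ : Set (Submodule F (Fin n → F)) := {V | ∃ ξ ∈ perp V, ξ ≠ 0 ∧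
      (Finset.univ.filter (fun j => ξ j ≠ 0)).card ≤ s} with hA₀
  set A₁ : Set (Submodule F (Fin n → F)) := {V | (∃ i : Fin n, δ ≤ bias ψ (w i) V) ∧
    ∀ i : Fin n, bias ψ (w i) V ≤ τ * (q ^ (n - k))⁻¹} with hA₁
  set T : Fin n → Set (Submodule F (Fin n → F)) := fun i => {V | V ∉ A₀ ∧ δ ≤ bias ψ (w i) V ∧
    τ * (q ^ (n - k))⁻¹ ≤ bias ψ (w i) V ∧ ∀ j : Fin n, bias ψ (w j) V ≤ bias ψ (w i) V} with hT
  have h0 : indepMass (fun i : Fin k => prodWeight (w i)) A₀ ≤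
      n.choose s * s * (1 - α) ^ (k - s) := by
    have := indepMass_sparse_le (u := fun i : Fin k => w i) (fun a => hw0 a) (fun a => hw1 a)
      (θ := 1 - α) (by linarith) (by linarith) (fun a j x => (hw a j).apply_le x) s
      (by rwa [Fintype.card_fin]) A₀ (fun V hV => hV)
    simpa only [Fintype.card_fin] using this
  have h1 : indepMass (fun i : Fin k => prodWeight (w i)) A₁ ≤
      n * (4 / δ) * (1 + τ) ^ k * √(1 - α) ^ n := by
    have := indepMass_le_of_le_bias (u := fun i : Fin k => prodWeight (w i))
      (w := fun i : Fin n => w i) hψ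
      (by rw [Fintype.card_fin]; exact hk.le) (fun a => hP0 a) (fun i => hw0 i) (fun i => hw1 i)
      (θ := 1 - α) (fun a j x => (hw a j).apply_le x) (A := 1 + τ) (by linarith) hδ A₁
      (fun V hV hVk a => by
        rw [Fintype.card_fin]
        refine (hmass V hVk a).trans ?_
        have := hV.2 ⟨a, a.2.trans hk⟩
        simp only at this
        linarith)
      (fun V hV _ => hV.1)
    simpa only [Fintype.card_fin] using this
  have h2 : ∀ i, indepMass (fun i : Fin k => prodWeight (w i)) (T i) ≤
      2 * 2 ^ k * ((τ⁻¹ + 1) * (2 * (2 / 3) ^ m)) ^ r := by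
    intro i
    have hQ0 : ∀ j x, 0 ≤ lazySymm β (w i j) x := fun j x =>
      lazySymm_nonneg hβ0 hβ1 (hw0 i j) x
    have hbias : ∀ V ∈ T i, bias ψ (w i) V ≤ 2 * (2 / 3) ^ m *
        submoduleMass (prodWeight (fun j => lazySymm β (w i j))) V := by
      intro V hV
      have h3 := bias_le_lazySymm_mass hψ hα0.le (hw i) V s m (by
        intro ξ hξ hne
        by_contra hlt
        exact hV.1 ⟨ξ, hξ, hne, (not_le.1 hlt).le⟩)
      have h4 := hV.2.1
      rw [← hβ] at h3
      linarith
    refine indepMass_le_of_swap (P := fun i : Fin k => prodWeight (w i)) (fun a => hP0 a)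
      (fun a => hP1 a) (Q := prodWeight (fun j => lazySymm β (w i j)))
      (fun z => prodWeight_nonneg hQ0 z)
      (by rw [sum_prodWeight]; simp [sum_lazySymm (hw1 i _)]) r (δ := δ / 2)
      (B := (1 - α * β) ^ (n - r)) (by linarith) (by positivity) ?_ (by linarith) (T i) ?_ ?_
    · intro U hU
      refine (submoduleMass_prodWeight_le hQ0 (fun j => sum_lazySymm (hw1 i j))
        (fun j x => lazySymm_le hβ0 hβ1 (hw i j) x) U).trans ?_
      refine pow_le_pow_of_le_one ?_ ?_ ?_
      · nlinarith
      · nlinarith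
      · rw [Fintype.card_fin]; omega
    · intro V hV _
      have h3 := hbias V hV
      have h4 := hV.2.1
      have h5 : (2 / 3 : ℝ) ^ m ≤ 1 := pow_le_one₀ (by norm_num) (by norm_num)
      have h6 := submoduleMass_nonneg (fun z => prodWeight_nonneg hQ0 z) V
      nlinarith
    · intro V hV hVk a
      have h3 := hbias V hV
      have h4 := hV.2.2.1
      have h5 := hV.2.2.2 ⟨a, a.2.trans hk⟩
      simp only at h5
      have h6 : (q ^ (n - k))⁻¹ ≤ τ⁻¹ * bias ψ (w i) V := by
        rw [inv_mul_eq_div, le_div_iff₀ hτ]; linarith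
      calc _ ≤ (q ^ (n - k))⁻¹ + bias ψ (w a) V := hmass V hVk a
        _ ≤ (τ⁻¹ + 1) * bias ψ (w i) V := by linarith
        _ ≤ (τ⁻¹ + 1) * (2 * (2 / 3) ^ m *
            submoduleMass (prodWeight (fun j => lazySymm β (w i j))) V) := by gcongr
        _ = _ := by ring
  have hcover := indepMass_mono_of_subset_union (F := F) (u := fun i : Fin k => prodWeight (w i))
    (fun a => hP0 a) (S := {V | δ < bias ψ (w k) V}) (A := A₀) (B := A₁) (C := ⋃ i, T i) (by
      intro V hV _
      by_cases hV0 : V ∈ A₀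
      · exact Or.inl hV0
      by_cases hV1 : V ∈ A₁
      · exact Or.inr (Or.inl hV1)
      refine Or.inr (Or.inr ?_)
      have : Nonempty (Fin n) := ⟨⟨k, hk⟩⟩
      obtain ⟨i, hi⟩ := Finite.exists_max (fun i : Fin n => bias ψ (w i) V)
      have h3 : δ ≤ bias ψ (w i) V := (show δ < bias ψ (w k) V from hV).le.trans (hi ⟨k, hk⟩)
      refine Set.mem_iUnion.2 ⟨i, hV0, h3, ?_, hi⟩
      by_contra hlt
      exact hV1 ⟨⟨i, h3⟩, fun j => (hi j).trans (not_le.1 hlt).le⟩)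
  have h3 := indepMass_le_sum_of_cover (F := F) (u := fun i : Fin k => prodWeight (w i))
    (fun a => hP0 a) (S := ⋃ i, T i) T (fun V hV => Set.mem_iUnion.1 hV)
  have h4 := Finset.sum_le_sum fun i (_ : i ∈ (Finset.univ : Finset (Fin n))) => h2 i
  rw [Finset.sum_const, Finset.card_univ, Fintype.card_fin, nsmul_eq_mul] at h4
  linarith

theorem abs_prod_one_sub_pow_sub_tprod_le {x : ℝ} (hx0 : 0 ≤ x) (hx : x ≤ 1 / 2) (D : ℕ) :
    |∏ j ∈ Finset.range D, (1 - x ^ (j + 1)) - ∏' j : ℕ, (1 - x ^ (j + 1))| ≤ (1 / 2) ^ D := by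
  have hx1 : ∀ k, x ^ k ≤ 1 := fun k => pow_le_one₀ hx0 (by linarith)
  have hxk : ∀ k, x ^ k ≤ (1 / 2) ^ k := fun k => pow_le_pow_left₀ hx0 hx k
  have hP0 : ∀ k, 0 ≤ ∏ j ∈ Finset.range k, (1 - x ^ (j + 1)) := fun k =>
    Finset.prod_nonneg fun j _ => sub_nonneg.2 (hx1 _)
  have hP1 : ∀ k, ∏ j ∈ Finset.range k, (1 - x ^ (j + 1)) ≤ 1 := fun k =>
    Finset.prod_le_one (fun j _ => sub_nonneg.2 (hx1 _))
      fun j _ => sub_le_self _ (pow_nonneg hx0 _)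
  have hm : Multipliable fun j : ℕ => 1 - x ^ (j + 1) := by
    have h : Summable fun j : ℕ => ‖-x ^ (j + 1)‖ := by
      simp only [norm_neg, norm_pow, Real.norm_eq_abs, abs_of_nonneg hx0]
      exact (summable_nat_add_iff 1).2 (summable_geometric_of_lt_one hx0 (by linarith))
    simpa only [← sub_eq_add_neg] using multipliable_one_add_of_summable h
  have ht := hm.hasProd.tendsto_prod_nat
  have hanti : Antitone fun k : ℕ => ∏ j ∈ Finset.range k, (1 - x ^ (j + 1)) := by
    refine antitone_nat_of_succ_le fun k => ?_
    rw [Finset.prod_range_succ]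
    exact mul_le_of_le_one_right (hP0 k) (sub_le_self _ (pow_nonneg hx0 _))
  have hmono : Monotone fun k : ℕ => ∏ j ∈ Finset.range k, (1 - x ^ (j + 1)) - (1 / 2 : ℝ) ^ k := by
    refine monotone_nat_of_le_succ fun k => ?_
    have h1 : (∏ j ∈ Finset.range k, (1 - x ^ (j + 1))) * x ^ (k + 1) ≤ (1 / 2) ^ (k + 1) :=
      (mul_le_of_le_one_left (pow_nonneg hx0 _) (hP1 k)).trans (hxk _)
    rw [Finset.prod_range_succ, pow_succ (1 / 2 : ℝ)] at *
    linarith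
  have h1 := hanti.le_of_tendsto ht D
  have h2 := hmono.ge_of_tendsto
    (ht.sub (tendsto_pow_atTop_nhds_zero_of_lt_one (by norm_num : (0 : ℝ) ≤ 1 / 2)
      (by norm_num))) D
  rw [abs_of_nonneg (sub_nonneg.2 h1)]
  simp only [sub_zero] at h2
  linarith

theorem matProb_det_ne_zero {F : Type*} [Field F] [Fintype F] {n : ℕ} (μ : Fin n → Fin n → F → ℝ) :
    matProb μ {M : Matrix (Fin n) (Fin n) F | M.det ≠ 0} =
      indepMass (F := F) (fun i : Fin n => prodWeight (μ i)) Set.univ := by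
  rw [matProb, indepMass, Finset.sum_filter, Finset.sum_filter]
  refine Finset.sum_congr rfl fun M _ => ?_
  have h : LinearIndependent F (M : Fin n → Fin n → F) ↔ M.det ≠ 0 := by
    rw [← isUnit_iff_ne_zero, ← Matrix.isUnit_iff_isUnit_det,
      ← Matrix.linearIndependent_rows_iff_isUnit]
    rfl
  have h' : M ∈ {M : Matrix (Fin n) (Fin n) F | M.det ≠ 0} ↔
      LinearIndependent F (M : Fin n → Fin n → F) ∧
        Submodule.span F (Set.range (M : Fin n → Fin n → F)) ∈ Set.univ :=
    ⟨fun hM => ⟨h.2 hM, trivial⟩, fun hM => h.1 hM.1⟩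
  by_cases hM : M.det ≠ 0
  · rw [if_pos (h'.1 hM)]
    exact if_pos hM
  · rw [if_neg fun hM' => hM (h'.2 hM')]
    exact if_neg hM

/-- Comparing the probability that independent random vectors are linearly independent with the
one for uniform vectors, assuming that the spans of the first few vectors rarely are biased. -/
theorem abs_indepMass_sub_prod_le {F : Type*} [Field F] [Fintype F] {ψ : AddChar F ℂ}
    (hψ : ψ.IsPrimitive) {α : ℝ} (hα0 : 0 < α) (hα1 : α < 1) {n D : ℕ} (hD : D ≤ n)
    {w : ℕ → Fin n → F → ℝ} (hw : ∀ i j, IsBalanced α (w i j)) {δ ε : ℝ} (hδ : 0 ≤ δ)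
    (hε : ∀ k, n - D ≤ k → k < n → indepMass (fun i : Fin k => prodWeight (w i))
      {V : Submodule F (Fin n → F) | δ < bias ψ (w k) V} ≤ ε) :
    |indepMass (F := F) (fun i : Fin n => prodWeight (w i)) Set.univ -
      ∏ j ∈ Finset.range D, (1 - (Fintype.card F : ℝ)⁻¹ ^ (j + 1))| ≤
      n * (1 - α) ^ D + D * (δ + ε) := by
  have hw0 : ∀ i j x, 0 ≤ w i j x := fun i j => (hw i j).1
  have hw1 : ∀ i j, ∑ x, w i j x = 1 := fun i j => (hw i j).2.1
  have hP0 : ∀ i z, 0 ≤ prodWeight (w i) z := fun i z => prodWeight_nonneg (hw0 i) z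
  have hP1 : ∀ i, ∑ z, prodWeight (w i) z = 1 := fun i => by rw [sum_prodWeight]; simp [hw1]
  set x : ℝ := (Fintype.card F : ℝ)⁻¹ with hx
  have hx0 : 0 ≤ x := by positivity
  have hx1 : x ≤ 1 := inv_le_one_of_one_le₀ (by exact_mod_cast Fintype.card_pos)
  have hstart : 1 - n * (1 - α) ^ D ≤
      indepMass (F := F) (fun i : Fin (n - D) => prodWeight (w i)) Set.univ := by
    have h1 := sum_prodWeight_not_linearIndependent_le (F := F)
      (u := fun i : Fin (n - D) => prodWeight (w i)) (fun a z => hP0 a z) ((1 - α) ^ D)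
      (fun j U hU => by
        refine (submoduleMass_prodWeight_le (hw0 j) (hw1 j) (θ := 1 - α)
          (fun a z => (hw j a).apply_le z) U).trans ?_
        refine pow_le_pow_of_le_one (by linarith) (by linarith) ?_
        simp only [Fintype.card_fin] at hU ⊢
        omega)
    simp only [hP1, Finset.prod_const_one, one_mul, Finset.sum_const, Finset.card_univ,
      Fintype.card_fin, nsmul_eq_mul] at h1
    have h2 : ∑ z, prodWeight (fun i : Fin (n - D) => prodWeight (w i)) z = 1 := by
      rw [sum_prodWeight]; simp [hP1]
    rw [← Finset.sum_filter_add_sum_filter_not _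
      (fun z : Fin (n - D) → Fin n → F => LinearIndependent F z)] at h2
    have h3 : indepMass (F := F) (fun i : Fin (n - D) => prodWeight (w i)) Set.univ =
        ∑ z with LinearIndependent F z, prodWeight (fun i : Fin (n - D) => prodWeight (w i)) z := by
      simp [indepMass]
    have h4 : ((n - D : ℕ) : ℝ) * (1 - α) ^ D ≤ n * (1 - α) ^ D :=
      mul_le_mul_of_nonneg_right (by exact_mod_cast Nat.sub_le n D)
        (pow_nonneg (by linarith) _)
    rw [h3]
    linarith
  have key : ∀ i, i ≤ D →
      |indepMass (F := F) (fun j : Fin (n - D + i) => prodWeight (w j)) Set.univ -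
        ∏ j ∈ Finset.Ico (D - i) D, (1 - x ^ (j + 1))| ≤ n * (1 - α) ^ D + i * (δ + ε) := by
    intro i
    induction i with
    | zero =>
      intro _
      have := indepMass_le_one (F := F) (u := fun i : Fin (n - D) => prodWeight (w i))
        (fun a z => hP0 a z) (fun a => hP1 a) Set.univ
      change |indepMass (F := F) (fun i : Fin (n - D) => prodWeight (w i)) Set.univ -
        ∏ j ∈ Finset.Ico D D, (1 - x ^ (j + 1))| ≤ _
      simp only [Finset.Ico_self, Finset.prod_empty, Nat.cast_zero, zero_mul, add_zero]
      rw [abs_sub_comm, abs_of_nonneg (by linarith)]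
      linarith
    | succ i ih =>
      intro hi
      have ih := ih (by omega)
      set k := n - D + i with hk
      have ht0 : 0 ≤ x ^ (D - i) := pow_nonneg hx0 _
      have ht1 : x ^ (D - i) ≤ 1 := pow_le_one₀ hx0 hx1
      have hstep := abs_indepMass_succ_sub_le (F := F) (k := k) (u := fun i => prodWeight (w i))
        hP0 hP1 ht0 ht1 hδ {V : Submodule F (Fin n → F) | δ < bias ψ (w k) V} (by
          intro V hV hVk
          have h := abs_submoduleMass_sub_le hψ V (hw1 k)
          rw [card_perp, hVk, Fintype.card_fin, Nat.cast_pow, ← inv_pow] at h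
          have e : n - k = D - i := by omega
          rw [e] at h
          exact h.trans (not_lt.1 hV))
      have hε' := hε k (by omega) (by omega)
      have hprod : ∏ j ∈ Finset.Ico (D - (i + 1)) D, (1 - x ^ (j + 1)) =
          (∏ j ∈ Finset.Ico (D - i) D, (1 - x ^ (j + 1))) * (1 - x ^ (D - i)) := by
        rw [Finset.prod_eq_prod_Ico_succ_bot (by omega), mul_comm]
        have e : D - (i + 1) + 1 = D - i := by omega
        rw [e]
      rw [hprod, ← add_assoc]
      push_cast
      set L := indepMass (F := F) (fun j : Fin k => prodWeight (w j)) Set.univ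
      set L' := indepMass (F := F) (fun j : Fin (k + 1) => prodWeight (w j)) Set.univ
      set P := ∏ j ∈ Finset.Ico (D - i) D, (1 - x ^ (j + 1))
      have e : L' - P * (1 - x ^ (D - i)) =
          (L' - L * (1 - x ^ (D - i))) + (L - P) * (1 - x ^ (D - i)) := by ring
      have h1 : |(L - P) * (1 - x ^ (D - i))| ≤ |L - P| := by
        rw [abs_mul, abs_of_nonneg (sub_nonneg.2 ht1)]
        exact mul_le_of_le_one_right (abs_nonneg _) (by linarith)
      rw [e]
      refine (abs_add_le _ _).trans ?_
      linarith
  have h := key D le_rfl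
  rw [Nat.sub_add_cancel hD, Nat.sub_self, ← Finset.range_eq_Ico] at h
  exact h

theorem eventually_pow_mul_exp_neg_le (p : ℕ) {b ε : ℝ} (hb : 0 < b) (hε : 0 < ε) :
    ∀ᶠ n : ℕ in Filter.atTop, (n : ℝ) ^ p * Real.exp (-(b * n)) ≤ ε := by
  have h := (tendsto_rpow_mul_exp_neg_mul_atTop_nhds_zero p b hb).comp
    (tendsto_natCast_atTop_atTop (R := ℝ))
  filter_upwards [h.eventually_le_const hε] with n hn
  simpa using hn

set_option maxHeartbeats 1000000 in
/-- Numerical parameters for which all error terms are exponentially small. -/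
theorem exists_error_parameters {α : ℝ} (hα0 : 0 < α) (hα1 : α < 1) :
    ∃ c C τ : ℝ, ∃ m : ℕ, 0 < c ∧ 0 < C ∧ 0 < τ ∧ (τ⁻¹ + 1) * (2 * (2 / 3) ^ m) ≤ 1 ∧
      ∀ᶠ n : ℕ in Filter.atTop, ∃ (s : ℕ) (δ : ℝ), s ≤ n ∧ 0 < δ ∧
        Real.exp (-(α * s / (2 * 4 ^ m))) ≤ δ / 2 ∧
        (n / 4 : ℕ) * (1 - α * (4 ^ (m + 1))⁻¹) ^ (n - n / 4) ≤ δ / 4 ∧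
        n * (1 - α) ^ (n / 4) + (n / 4 : ℕ) * (δ + (n.choose s * s * (1 - α) ^ (n - n / 4 - s) +
          n * (4 / δ) * (1 + τ) ^ n * √(1 - α) ^ n +
          n * (2 * 2 ^ n * ((τ⁻¹ + 1) * (2 * (2 / 3) ^ m)) ^ (n / 4)))) + (1 / 2) ^ (n / 4) ≤
        C * Real.exp (-(c * n)) := by
  obtain ⟨l, hl⟩ : ∃ l, l = -Real.log (1 - α) := ⟨_, rfl⟩
  have hl0 : 0 < l := by rw [hl]; exact neg_pos.2 (Real.log_neg (by linarith) (by linarith))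
  have hθ : 1 - α = Real.exp (-l) := by rw [hl, neg_neg, Real.exp_log (by linarith)]
  obtain ⟨τ, hτ⟩ : ∃ τ, τ = Real.exp (l / 8) - 1 := ⟨_, rfl⟩
  have hτ0 : 0 < τ := by rw [hτ]; exact sub_pos.2 (Real.one_lt_exp_iff.2 (by linarith))
  have h1τ : 1 + τ = Real.exp (l / 8) := by rw [hτ]; ring
  obtain ⟨κ, hκ⟩ : ∃ κ, κ = Real.log (1 + τ⁻¹) := ⟨_, rfl⟩
  have hτi : 0 < τ⁻¹ := inv_pos.2 hτ0
  have hκ0 : 0 < κ := by rw [hκ]; exact Real.log_pos (by linarith)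
  have hκτ : τ⁻¹ ≤ Real.exp κ := by rw [hκ, Real.exp_log (by linarith)]; linarith
  obtain ⟨ρ, hρ⟩ : ∃ ρ, ρ = min (1 / 4) (l / (16 * κ)) := ⟨_, rfl⟩
  have hρ0 : 0 < ρ := by rw [hρ]; positivity
  have hρ4 : ρ ≤ 1 / 4 := by rw [hρ]; exact min_le_left _ _
  have hρκ : κ * ρ ≤ l / 16 := by
    have h : ρ ≤ l / (16 * κ) := by rw [hρ]; exact min_le_right _ _
    rw [le_div_iff₀ (by positivity)] at h
    linarith
  obtain ⟨m, hm⟩ : ∃ m : ℕ, (τ⁻¹ + 1) * (2 * (2 / 3) ^ m) ≤ (2 ^ 8)⁻¹ := by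
    obtain ⟨m, hm⟩ := exists_pow_lt_of_lt_one
      (show (0 : ℝ) < (2 ^ 8)⁻¹ / (2 * (τ⁻¹ + 1)) by positivity)
      (show (2 / 3 : ℝ) < 1 by norm_num)
    refine ⟨m, ?_⟩
    rw [lt_div_iff₀ (by positivity)] at hm
    linarith
  obtain ⟨l', hl'⟩ : ∃ l', l' = -Real.log (1 - α * (4 ^ (m + 1))⁻¹) := ⟨_, rfl⟩
  have hβ0 : (0 : ℝ) < (4 ^ (m + 1))⁻¹ := by positivity
  have hβ1 : ((4 : ℝ) ^ (m + 1))⁻¹ ≤ 1 := inv_le_one_of_one_le₀ (one_le_pow₀ (by norm_num))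
  have hγ0 : 0 < 1 - α * (4 ^ (m + 1))⁻¹ := by nlinarith
  have hl'0 : 0 < l' := by
    rw [hl']
    exact neg_pos.2 (Real.log_neg hγ0 (by nlinarith))
  have hγ : 1 - α * (4 ^ (m + 1))⁻¹ = Real.exp (-l') := by rw [hl', neg_neg, Real.exp_log hγ0]
  obtain ⟨g, hg⟩ : ∃ g, g = α / (2 * 4 ^ m) := ⟨_, rfl⟩
  have hg0 : 0 < g := by rw [hg]; positivity
  obtain ⟨c₁, hc₁⟩ : ∃ c₁, c₁ = min (l / 8) (min (g * ρ / 2) (l' / 4)) := ⟨_, rfl⟩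
  have hc₁0 : 0 < c₁ := by rw [hc₁]; positivity
  have hc₁l : c₁ ≤ l / 8 := by rw [hc₁]; exact min_le_left _ _
  have hc₁g : c₁ ≤ g * ρ / 2 := by
    rw [hc₁]; exact (min_le_right _ _).trans (min_le_left _ _)
  have hc₁l' : c₁ ≤ l' / 4 := by
    rw [hc₁]; exact (min_le_right _ _).trans (min_le_right _ _)
  have hlog2 : 0 < Real.log 2 := Real.log_pos (by norm_num)
  obtain ⟨c₀, hc₀⟩ : ∃ c₀, c₀ = min c₁ (Real.log 2 / 4) := ⟨_, rfl⟩
  have hc₀0 : 0 < c₀ := by rw [hc₀]; positivity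
  have hc₀c₁ : c₀ ≤ c₁ := by rw [hc₀]; exact min_le_left _ _
  have hc₀2 : c₀ ≤ Real.log 2 / 4 := by rw [hc₀]; exact min_le_right _ _
  refine ⟨c₀ / 2, Real.exp l + 136, τ, m, by positivity, by positivity, hτ0,
    hm.trans (by norm_num), ?_⟩
  filter_upwards [Filter.eventually_ge_atTop 1,
    eventually_pow_mul_exp_neg_le 0 (show 0 < g * ρ / 2 by positivity)
      (show 0 < Real.exp (-g) / 2 by positivity),
    eventually_pow_mul_exp_neg_le 1 (show 0 < l' / 4 by positivity)
      (show (0 : ℝ) < 1 / 4 by norm_num),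
    eventually_pow_mul_exp_neg_le 2 (show 0 < c₀ / 2 by positivity) one_pos]
    with n hn hn1 hn2 hn3
  have hn' : (1 : ℝ) ≤ n := by exact_mod_cast hn
  set D := n / 4 with hD
  have hD1 : (D : ℝ) ≤ n / 4 := by
    have : 4 * D ≤ n := by omega
    have : (4 : ℝ) * D ≤ n := by exact_mod_cast this
    linarith
  have hD2 : (n : ℝ) / 4 - 3 / 4 ≤ D := by
    have : n ≤ 4 * D + 3 := by omega
    have : (n : ℝ) ≤ 4 * D + 3 := by exact_mod_cast this
    linarith
  set s := ⌊ρ * n⌋₊ with hs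
  have hs1 : (s : ℝ) ≤ ρ * n := Nat.floor_le (by positivity)
  have hs2 : ρ * n - 1 ≤ s := (Nat.sub_one_lt_floor _).le
  have hs4 : (s : ℝ) ≤ n / 4 := by
    have := mul_le_mul_of_nonneg_right hρ4 (show (0 : ℝ) ≤ n by linarith)
    linarith
  have hs4' : 4 * s ≤ n := by
    have : (4 : ℝ) * s ≤ n := by linarith
    exact_mod_cast this
  refine ⟨s, Real.exp (-(c₁ * n)), by omega, Real.exp_pos _, ?_, ?_, ?_⟩
  · have e : -(α * s / (2 * 4 ^ m)) = -(g * s) := by rw [hg]; ring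
    rw [e]
    simp only [pow_zero, one_mul] at hn1
    calc Real.exp (-(g * s)) ≤ Real.exp (-(c₁ * n)) * (Real.exp (-(g * ρ / 2 * n)) * Real.exp g) := by
          rw [← Real.exp_add, ← Real.exp_add]
          refine Real.exp_le_exp.2 ?_
          have h1 := mul_le_mul_of_nonneg_right hc₁g (show (0 : ℝ) ≤ n by linarith)
          have h2 := mul_le_mul_of_nonneg_left hs2 hg0.le
          linarith
      _ ≤ Real.exp (-(c₁ * n)) * (Real.exp (-g) / 2 * Real.exp g) := by gcongr
      _ = Real.exp (-(c₁ * n)) / 2 := by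
          rw [div_mul_eq_mul_div, ← Real.exp_add, neg_add_cancel, Real.exp_zero]; ring
  · rw [hγ, ← Real.exp_nat_mul, Nat.cast_sub (by omega)]
    rw [pow_one] at hn2
    calc (D : ℝ) * Real.exp ((n - D) * -l') ≤
          n * (Real.exp (-(l' / 4 * n)) * Real.exp (-(c₁ * n))) := by
          rw [← Real.exp_add]
          refine mul_le_mul (by linarith) (Real.exp_le_exp.2 ?_) (Real.exp_pos _).le (by linarith)
          have h1 := mul_le_mul_of_nonneg_right hc₁l' (show (0 : ℝ) ≤ n by linarith)
          have h2 := mul_le_mul_of_nonneg_right hD1 hl'0.le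
          linarith [mul_pos hl'0 (show (0 : ℝ) < n by linarith)]
      _ = n * Real.exp (-(l' / 4 * n)) * Real.exp (-(c₁ * n)) := by ring
      _ ≤ 1 / 4 * Real.exp (-(c₁ * n)) := by gcongr
      _ = _ := by ring
  · have hE : ∀ {x : ℝ}, x ≤ -(c₀ * n) → Real.exp x ≤ Real.exp (-(c₀ * n)) :=
      fun h => Real.exp_le_exp.2 h
    set E := Real.exp (-(c₀ * n)) with hEdef
    have hE0 : 0 < E := Real.exp_pos _
    have hc₁n : c₁ * n ≤ l / 8 * n := by gcongr
    have hc₀n : c₀ * n ≤ c₁ * n := by gcongr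
    have hc₀n2 : c₀ * n ≤ Real.log 2 / 4 * n := by gcongr
    have hln : 0 < l * n := by positivity
    have hlog2n : 0 < Real.log 2 * n := by positivity
    have hlD := mul_le_mul_of_nonneg_left hD1 hl0.le
    have hlD' := mul_le_mul_of_nonneg_left hD2 hl0.le
    have hls := mul_le_mul_of_nonneg_left hs4 hl0.le
    have hlog2D := mul_le_mul_of_nonneg_left hD2 hlog2.le
    have t1 : (1 - α) ^ D ≤ Real.exp l * E := by
      rw [hθ, ← Real.exp_nat_mul, hEdef, ← Real.exp_add]
      refine Real.exp_le_exp.2 ?_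
      linarith
    have t2 : Real.exp (-(c₁ * n)) ≤ E := hE (by linarith)
    have t3 : n.choose s * s * (1 - α) ^ (n - D - s) ≤ n * E := by
      have h1 : (n.choose s : ℝ) ≤ (1 + τ) ^ n * (τ⁻¹) ^ s := by
        have h := Finset.single_le_sum (f := fun i => τ ^ i * 1 ^ (n - i) * (n.choose i : ℝ))
          (fun i _ => by positivity) (Finset.mem_range.2 (show s < n + 1 by omega))
        rw [← add_pow] at h
        simp only [one_pow, mul_one] at h
        rw [inv_pow, ← div_eq_mul_inv, le_div_iff₀ (by positivity), add_comm 1 τ]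
        linarith
      have h2 : (τ⁻¹) ^ s ≤ Real.exp (l / 16 * n) := by
        refine (pow_le_pow_left₀ hτi.le hκτ s).trans ?_
        rw [← Real.exp_nat_mul]
        refine Real.exp_le_exp.2 ?_
        calc (s : ℝ) * κ ≤ ρ * n * κ := by gcongr
          _ = κ * ρ * n := by ring
          _ ≤ l / 16 * n := by gcongr
      have h3 : (1 - α) ^ (n - D - s) ≤ Real.exp (-(l / 2 * n)) := by
        rw [hθ, ← Real.exp_nat_mul, Nat.cast_sub (by omega), Nat.cast_sub (by omega)]
        refine Real.exp_le_exp.2 ?_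
        linarith
      rw [h1τ, ← Real.exp_nat_mul] at h1
      calc n.choose s * s * (1 - α) ^ (n - D - s)
          ≤ (Real.exp (n * (l / 8)) * Real.exp (l / 16 * n)) * n * Real.exp (-(l / 2 * n)) := by
            have h4 : (n.choose s : ℝ) ≤ Real.exp (n * (l / 8)) * Real.exp (l / 16 * n) :=
              h1.trans (by gcongr)
            have h5 : (s : ℝ) ≤ n := by linarith
            have h6 : (0 : ℝ) ≤ (1 - α) ^ (n - D - s) := pow_nonneg (by linarith) _
            gcongr
        _ = n * Real.exp (n * (l / 8) + l / 16 * n + -(l / 2 * n)) := by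
            rw [Real.exp_add, Real.exp_add]; ring
        _ ≤ n * E := by
            gcongr
            refine hE ?_
            linarith
    have t4 : n * (4 / Real.exp (-(c₁ * n))) * (1 + τ) ^ n * √(1 - α) ^ n ≤ 4 * n * E := by
      have hsq : √(1 - α) = Real.exp (-l / 2) := by rw [hθ, Real.exp_half]
      rw [h1τ, hsq, ← Real.exp_nat_mul, ← Real.exp_nat_mul, div_eq_mul_inv, ← Real.exp_neg]
      calc _ = 4 * n * Real.exp (-(-(c₁ * n)) + n * (l / 8) + n * (-l / 2)) := by
            rw [Real.exp_add, Real.exp_add]; ring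
        _ ≤ 4 * n * E := by
            gcongr
            refine hE ?_
            linarith
    have t5 : n * (2 * 2 ^ n * ((τ⁻¹ + 1) * (2 * (2 / 3) ^ m)) ^ D) ≤ 128 * n * E := by
      have h1 : ((τ⁻¹ + 1) * (2 * (2 / 3) ^ m)) ^ D ≤ ((2 : ℝ) ^ (8 * D))⁻¹ := by
        rw [pow_mul, ← inv_pow]
        exact pow_le_pow_left₀ (by positivity) hm D
      have h2 : (2 : ℝ) ^ n * (2 ^ (8 * D))⁻¹ ≤ 64 * (2 ^ n)⁻¹ := by
        rw [← div_eq_mul_inv, ← div_eq_mul_inv, div_le_div_iff₀ (by positivity) (by positivity)]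
        calc (2 : ℝ) ^ n * 2 ^ n = 2 ^ (n + n) := (pow_add _ _ _).symm
          _ ≤ 2 ^ (6 + 8 * D) := pow_le_pow_right₀ (by norm_num) (by omega)
          _ = 64 * 2 ^ (8 * D) := by rw [pow_add]; norm_num
      have h3 : ((2 : ℝ) ^ n)⁻¹ ≤ E := by
        have : (2 : ℝ) ^ n = Real.exp (n * Real.log 2) := by
          rw [Real.exp_nat_mul, Real.exp_log (by norm_num)]
        rw [this, ← Real.exp_neg]
        refine hE ?_
        linarith
      calc n * (2 * 2 ^ n * ((τ⁻¹ + 1) * (2 * (2 / 3) ^ m)) ^ D)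
          ≤ n * (2 * 2 ^ n * ((2 : ℝ) ^ (8 * D))⁻¹) := by gcongr
        _ = n * (2 * (2 ^ n * ((2 : ℝ) ^ (8 * D))⁻¹)) := by ring
        _ ≤ n * (2 * (64 * E)) := by
            refine mul_le_mul_of_nonneg_left (mul_le_mul_of_nonneg_left (h2.trans ?_) ?_) ?_
            exacts [mul_le_mul_of_nonneg_left h3 (by norm_num), by norm_num, by linarith]
        _ = 128 * n * E := by ring
    have t6 : (1 / 2 : ℝ) ^ D ≤ 2 * E := by
      have h2 : (1 / 2 : ℝ) = Real.exp (-Real.log 2) := by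
        rw [Real.exp_neg, Real.exp_log (by norm_num), one_div]
      have h3 : 2 * E = Real.exp (Real.log 2 + -(c₀ * n)) := by
        rw [Real.exp_add, Real.exp_log (by norm_num)]
      rw [h3, h2, ← Real.exp_nat_mul]
      refine Real.exp_le_exp.2 ?_
      linarith
    have hDn : (D : ℝ) ≤ n := by linarith
    have hnn : (n : ℝ) ≤ n ^ 2 := by nlinarith
    have hE2 : (n : ℝ) ^ 2 * E ≤ Real.exp (-(c₀ / 2 * n)) := by
      have : E = Real.exp (-(c₀ / 2 * n)) * Real.exp (-(c₀ / 2 * n)) := by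
        rw [← Real.exp_add, hEdef]; ring_nf
      rw [this, ← mul_assoc]
      exact mul_le_of_le_one_left (Real.exp_pos _).le hn3
    have hin : Real.exp (-(c₁ * n)) + (n.choose s * s * (1 - α) ^ (n - D - s) +
        n * (4 / Real.exp (-(c₁ * n))) * (1 + τ) ^ n * √(1 - α) ^ n +
        n * (2 * 2 ^ n * ((τ⁻¹ + 1) * (2 * (2 / 3) ^ m)) ^ D)) ≤ 134 * n * E := by
      have : E ≤ n * E := le_mul_of_one_le_left hE0.le hn'
      linarith
    calc _ ≤ n * (Real.exp l * E) + n * (134 * n * E) + 2 * E := by gcongr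
      _ ≤ n ^ 2 * (Real.exp l * E) + n ^ 2 * (134 * E) + n ^ 2 * (2 * E) := by
          have h1 : (1 : ℝ) ≤ n ^ 2 := by nlinarith
          have h2 : n * (Real.exp l * E) ≤ n ^ 2 * (Real.exp l * E) := by gcongr
          have h3 : 1 * (2 * E) ≤ n ^ 2 * (2 * E) := by gcongr
          linarith
      _ = (Real.exp l + 136) * (n ^ 2 * E) := by ring
      _ ≤ _ := by gcongr

/-- The probability that a random matrix with balanced entries is nonsingular, for large sizes. -/
theorem eventually_abs_matProb_sub_le {α : ℝ} (hα0 : 0 < α) (hα1 : α < 1) :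
    ∃ c C : ℝ, 0 < c ∧ 0 < C ∧ ∀ᶠ n : ℕ in Filter.atTop, ∀ (F : Type) [Field F] [Fintype F],
      ∀ μ : Fin n → Fin n → F → ℝ, (∀ i j, IsBalanced α (μ i j)) →
        |matProb μ {M : Matrix (Fin n) (Fin n) F | M.det ≠ 0} -
            ∏' i : ℕ, (1 - ((Fintype.card F : ℝ))⁻¹ ^ (i + 1))| ≤ C * Real.exp (-(c * n)) := by
  obtain ⟨c, C, τ, m, hc, hC, hτ, hη, h⟩ := exists_error_parameters hα0 hα1
  refine ⟨c, C, hc, hC, ?_⟩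
  filter_upwards [h, Filter.eventually_gt_atTop 0] with n hn hn0 F _ _ μ hμ
  obtain ⟨s, δ, hs, hδ, hsδ, hrδ, htot⟩ := hn
  obtain ⟨ψ, hψ⟩ := exists_isPrimitive_addChar F
  set w : ℕ → Fin n → F → ℝ := fun i => if h : i < n then μ ⟨i, h⟩ else μ ⟨0, hn0⟩ with hw
  have hwb : ∀ i j, IsBalanced α (w i j) := by
    intro i j
    simp only [hw]
    split_ifs
    exacts [hμ _ _, hμ _ _]
  have hmain := abs_indepMass_sub_prod_le hψ hα0 hα1 (Nat.div_le_self n 4) hwb hδ.le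
    (ε := n.choose s * s * (1 - α) ^ (n - n / 4 - s) +
          n * (4 / δ) * (1 + τ) ^ n * √(1 - α) ^ n +
          n * (2 * 2 ^ n * ((τ⁻¹ + 1) * (2 * (2 / 3) ^ m)) ^ (n / 4)))
    (fun k hk1 hk2 => by
      refine (indepMass_lt_bias_le hψ hα0 hα1 hk2 hwb s m (n / 4) hs hτ hδ hsδ hrδ).trans ?_
      have h1 : (1 - α) ^ (k - s) ≤ (1 - α) ^ (n - n / 4 - s) :=
        pow_le_pow_of_le_one (by linarith) (by linarith) (by omega)
      have h2 : (1 + τ) ^ k ≤ (1 + τ) ^ n := pow_le_pow_right₀ (by linarith) hk2.le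
      have h3 : (2 : ℝ) ^ k ≤ 2 ^ n := pow_le_pow_right₀ (by norm_num) hk2.le
      gcongr)
  have hq : (Fintype.card F : ℝ)⁻¹ ≤ 1 / 2 := by
    rw [one_div]
    exact inv_anti₀ (by norm_num) (by exact_mod_cast Fintype.one_lt_card)
  have htail := abs_prod_one_sub_pow_sub_tprod_le
    (inv_nonneg.2 (Nat.cast_nonneg (Fintype.card F))) hq (n / 4)
  have hrow : (fun i : Fin n => prodWeight (w i)) = fun i => prodWeight (μ i) := by
    ext i
    simp [hw]
  rw [hrow] at hmain
  rw [matProb_det_ne_zero]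
  refine (abs_sub_le _ (∏ j ∈ Finset.range (n / 4), (1 - (Fintype.card F : ℝ)⁻¹ ^ (j + 1))) _).trans
    ((add_le_add hmain htail).trans htot)

theorem matProb_det_ne_zero_mem_Icc {F : Type*} [Field F] [Fintype F] {α : ℝ} {n : ℕ}
    {μ : Fin n → Fin n → F → ℝ} (hμ : ∀ i j, IsBalanced α (μ i j)) :
    matProb μ {M : Matrix (Fin n) (Fin n) F | M.det ≠ 0} ∈ Set.Icc (0 : ℝ) 1 := by
  rw [matProb_det_ne_zero]
  have h0 : ∀ i z, 0 ≤ prodWeight (μ i) z := fun i z => prodWeight_nonneg (fun j => (hμ i j).1) z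
  refine ⟨indepMass_nonneg h0 _, indepMass_le_one h0 (fun i => ?_) _⟩
  rw [sum_prodWeight]
  exact Finset.prod_eq_one fun j _ => (hμ i j).2.1

theorem stmt2 (α : ℝ) (hα0 : 0 < α) (hα1 : α < 1) :
    ∃ c C : ℝ, 0 < c ∧ 0 < C ∧
      ∀ (F : Type) [Field F] [Fintype F], ∀ n : ℕ, 1 ≤ n →
        ∀ μ : Fin n → Fin n → F → ℝ, (∀ i j, IsBalanced α (μ i j)) →
          |matProb μ {M : Matrix (Fin n) (Fin n) F | M.det ≠ 0} -
              ∏' i : ℕ, (1 - ((Fintype.card F : ℝ))⁻¹ ^ (i + 1))| ≤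
            C * Real.exp (-(c * α * n)) := by
  obtain ⟨c, C, hc, hC, h⟩ := eventually_abs_matProb_sub_le hα0 hα1
  obtain ⟨N, hN⟩ := Filter.eventually_atTop.1 h
  refine ⟨c / α, C + 2 * Real.exp (c * N), by positivity, by positivity, ?_⟩
  intro F _ _ n _ μ hμ
  rw [div_mul_cancel₀ c hα0.ne']
  rcases le_or_gt N n with hn | hn
  · refine (hN n hn F μ hμ).trans ?_
    gcongr
    linarith [Real.exp_pos (c * N)]
  · have hP := matProb_det_ne_zero_mem_Icc hμ
    have hq : (Fintype.card F : ℝ)⁻¹ ≤ 1 / 2 := by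
      rw [one_div]
      exact inv_anti₀ (by norm_num) (by exact_mod_cast Fintype.one_lt_card)
    have htail := abs_prod_one_sub_pow_sub_tprod_le
      (inv_nonneg.2 (Nat.cast_nonneg (Fintype.card F))) hq 0
    rw [Finset.prod_range_zero, pow_zero] at htail
    have h2 : 2 ≤ 2 * Real.exp (c * N) * Real.exp (-(c * n)) := by
      rw [mul_assoc, ← Real.exp_add]
      have : c * n ≤ c * N := by gcongr
      linarith [Real.one_le_exp (show 0 ≤ c * N + -(c * n) by linarith)]
    have h3 : 0 < C * Real.exp (-(c * n)) := by positivity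
    have h4 := abs_le.1 htail
    rw [add_mul]
    refine abs_le.2 ⟨by linarith [hP.1, hP.2, h4.1, h4.2], by linarith [hP.1, hP.2, h4.1, h4.2]⟩
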